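/- For every positive integer d there exist a compact metric space (𝒳, 𝐝), a continuous action T : ℝ^d × 𝒳 → 𝒳, and invariant measures ν_1, ν_2 ∈ M^T(𝒳) satisfying: (i) the upper metric mean dimension umdim_M(𝒳,T,𝐝) is finite; (ii) urdim(𝒳,T,𝐝,ν_1) = urdim(𝒳,T,𝐝,ν_2) = 1; and (iii) urdim(𝒳,T,𝐝, ½ν_1 + ½ν_2) ≤ ½. In particular, the inequality urdim(𝒳,T,𝐝, ∫ν dλ(ν)) ≤ ∫ urdim(𝒳,T,𝐝,ν) dλ(ν) can be strict even under finite upper metric mean dimension. -/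

import Mathlib

open MeasureTheory Filter Set
open scoped ENNReal Topology NNReal

noncomputable section

/-- Shannon entropy (base 2) of a finitely-valued random variable. -/
def shannonEntropy {Ω S : Type*} [MeasurableSpace Ω] [Fintype S]
    (P : Measure Ω) (f : Ω → S) : ℝ :=
  -∑ i : S, ((P (f ⁻¹' {i})).toReal * Real.logb 2 ((P (f ⁻¹' {i})).toReal))

/-- Mutual information (base 2) of two random variables, defined as the supremum over all
finite measurable partitions (encoded as measurable maps into `Fin n`) of
`H(α∘X) + H(β∘Y) - H(α∘X, β∘Y)`. -/
def mutualInfo {Ω A B : Type*} [MeasurableSpace Ω] [MeasurableSpace A] [MeasurableSpace B]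
    (P : Measure Ω) (X : Ω → A) (Y : Ω → B) : ℝ≥0∞ :=
  ⨆ (n : ℕ) (m : ℕ) (α : A → Fin n) (_ : Measurable α) (β : B → Fin m) (_ : Measurable β),
    ENNReal.ofReal (shannonEntropy P (fun ω => α (X ω)) + shannonEntropy P (fun ω => β (Y ω))
      - shannonEntropy P (fun ω => (α (X ω), β (Y ω))))

/-- The box `[0,L)^d ⊆ ℝ^d`. -/
def unitBox (d : ℕ) (L : ℝ) : Set (Fin d → ℝ) := Set.univ.pi fun _ => Set.Ico (0 : ℝ) L

/-- Lebesgue measure on `ℝ^d` restricted to the box `[0,L)^d`. -/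
def boxMeasure (d : ℕ) (L : ℝ) : Measure (Fin d → ℝ) := volume.restrict (unitBox d L)

/-- The space `L¹([0,L)^d, X)` of measurable maps modulo a.e. equality. -/
abbrev L1Maps (d : ℕ) (L : ℝ) (X : Type*) [TopologicalSpace X] :=
  (Fin d → ℝ) →ₘ[boxMeasure d L] X

/-- The `L¹` distance `D(f,g) = ∫_{[0,L)^d} 𝐝(f(u), g(u)) dm(u)`. -/
def L1dist {d : ℕ} {L : ℝ} {X : Type*} [MetricSpace X] (f g : L1Maps d L X) : ℝ :=
  ∫ u, dist (f u) (g u) ∂(boxMeasure d L)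

/-- The Borel σ-algebra of the metric `L1dist` on `L¹([0,L)^d, X)`,
generated by the open balls of the metric. -/
instance L1Maps.measurableSpace {d : ℕ} {L : ℝ} {X : Type*} [MetricSpace X] :
    MeasurableSpace (L1Maps d L X) :=
  MeasurableSpace.generateFrom {s | ∃ (f : L1Maps d L X) (r : ℝ), s = {g | L1dist f g < r}}

/-- The expected mean distortion `E[(1/L^d) ∫_{[0,L)^d} 𝐝(T^u X, Y_u) dm(u)]`. -/
def distortion {X : Type*} [MetricSpace X] (d : ℕ) (T : (Fin d → ℝ) → X → X) (L : ℝ)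
    {Ω : Type*} [MeasurableSpace Ω] (P : Measure Ω) (Xv : Ω → X) (Yv : Ω → L1Maps d L X) : ℝ :=
  ∫ ω, (L ^ d)⁻¹ * ∫ u, dist (T u (Xv ω)) (Yv ω u) ∂(boxMeasure d L) ∂P

/-- `R_L(𝐝, μ, ε)`: the infimum of `I(X;Y)` over all pairs of random variables on a common
probability space with `Law X = μ`, `Y` taking values in `L¹([0,L)^d, X)` and expected mean
distortion `< ε`. -/
def RL {X : Type*} [MetricSpace X] [MeasurableSpace X] (d : ℕ)
    (T : (Fin d → ℝ) → X → X) (μ : Measure X) (L ε : ℝ) : ℝ≥0∞ :=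
  ⨅ (Ω : Type) (_ : MeasurableSpace Ω) (P : Measure Ω) (_ : IsProbabilityMeasure P)
    (Xv : Ω → X) (Yv : Ω → L1Maps d L X) (_ : Measurable Xv) (_ : Measurable Yv)
    (_ : Measure.map Xv P = μ) (_ : distortion d T L P Xv Yv < ε),
    mutualInfo P Xv Yv

/-- The rate distortion function `R(𝐝, μ, ε) = lim_{L→∞} R_L(𝐝, μ, ε)/L^d`, which exists and
equals `inf_{L>0} R_L(𝐝, μ, ε)/L^d`. -/
def RD {X : Type*} [MetricSpace X] [MeasurableSpace X] (d : ℕ)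
    (T : (Fin d → ℝ) → X → X) (μ : Measure X) (ε : ℝ) : ℝ≥0∞ :=
  ⨅ (L : ℝ) (_ : 0 < L), RL d T μ L ε / ENNReal.ofReal (L ^ d)

/-- Upper rate distortion dimension. -/
def urdim {X : Type*} [MetricSpace X] [MeasurableSpace X] (d : ℕ)
    (T : (Fin d → ℝ) → X → X) (μ : Measure X) : ℝ≥0∞ :=
  Filter.limsup (fun ε : ℝ => RD d T μ ε / ENNReal.ofReal (Real.logb 2 (1 / ε))) (𝓝[>] (0 : ℝ))

/-- Lower rate distortion dimension. -/
def lrdim {X : Type*} [MetricSpace X] [MeasurableSpace X] (d : ℕ)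
    (T : (Fin d → ℝ) → X → X) (μ : Measure X) : ℝ≥0∞ :=
  Filter.liminf (fun ε : ℝ => RD d T μ ε / ENNReal.ofReal (Real.logb 2 (1 / ε))) (𝓝[>] (0 : ℝ))

/-- `μ` is invariant under the `ℝ^d`-action `T`. -/
def MeasInvariant {X : Type*} [MeasurableSpace X] (d : ℕ)
    (T : (Fin d → ℝ) → X → X) (μ : Measure X) : Prop :=
  ∀ u : Fin d → ℝ, Measure.map (T u) μ = μ

/-- `T` is a continuous action of the additive group `ℝ^d`. -/
def IsContAction {X : Type*} [TopologicalSpace X] (d : ℕ) (T : (Fin d → ℝ) → X → X) : Prop :=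
  Continuous (fun p : (Fin d → ℝ) × X => T p.1 p.2) ∧ (∀ x, T 0 x = x) ∧
    ∀ u v x, T (u + v) x = T u (T v x)

/-- The metric `𝐝_L(x,y) = sup_{u ∈ [0,L)^d} 𝐝(T^u x, T^u y)`. -/
def dSup {X : Type*} [MetricSpace X] (d : ℕ) (T : (Fin d → ℝ) → X → X) (L : ℝ) (x y : X) : ℝ :=
  ⨆ u : unitBox d L, dist (T u.1 x) (T u.1 y)

/-- The `ε`-covering number of `X` for the (pre)metric `ρ`: the minimal number of open sets
of `ρ`-diameter `< ε` covering `X`. -/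
def covNum (X : Type*) [TopologicalSpace X] (ρ : X → X → ℝ) (ε : ℝ) : ℕ :=
  sInf {n : ℕ | ∃ F : Finset (Set X), F.card = n ∧
    (∀ U ∈ F, IsOpen U ∧ (⨆ x ∈ U, ⨆ y ∈ U, ENNReal.ofReal (ρ x y)) < ENNReal.ofReal ε) ∧
    ⋃₀ (F : Set (Set X)) = Set.univ}

/-- The entropy at scale `ε`: `S(X,T,𝐝,ε) = lim_{L→∞} log₂ #(X, 𝐝_L, ε) / L^d`
(the limit exists, hence equals the limsup used here). -/
def entScale {X : Type*} [MetricSpace X] (d : ℕ) (T : (Fin d → ℝ) → X → X) (ε : ℝ) : ℝ≥0∞ :=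
  Filter.limsup
    (fun L : ℝ => ENNReal.ofReal (Real.logb 2 (covNum X (dSup d T L) ε) / L ^ d)) Filter.atTop

/-- The upper metric mean dimension. -/
def umdim {X : Type*} [MetricSpace X] (d : ℕ) (T : (Fin d → ℝ) → X → X) : ℝ≥0∞ :=
  Filter.limsup (fun ε : ℝ => entScale d T ε / ENNReal.ofReal (Real.logb 2 (1 / ε))) (𝓝[>] (0 : ℝ))

/-- The σ-algebra on the space of Borel probability measures on `X` (for a compact metric `X`
this is the Borel σ-algebra of the weak* topology). -/
instance ProbabilityMeasure.measurableSpace' {α : Type*} [MeasurableSpace α] :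
    MeasurableSpace (ProbabilityMeasure α) :=
  inferInstanceAs (MeasurableSpace {μ : Measure α // IsProbabilityMeasure μ})

/-- The space `M^T(X)` of `T`-invariant Borel probability measures on `X`. -/
abbrev InvM (X : Type*) [MeasurableSpace X] [MetricSpace X] (d : ℕ)
    (T : (Fin d → ℝ) → X → X) :=
  {ν : ProbabilityMeasure X // MeasInvariant d T (ν : Measure X)}

end

open MeasureTheory Filter Set
open scoped ENNReal Topology NNReal

namespace RDX

noncomputable section

/-! ### The alphabet -/

/-- The Banach space containing the alphabet. -/
abbrev V := lp (fun _ : ℕ => ℝ) 1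

def bit (b : Bool) : ℝ := if b then 1 else 0

lemma bit_nonneg (b : Bool) : 0 ≤ bit b := by cases b <;> simp [bit]
lemma bit_le (b : Bool) : bit b ≤ 1 := by cases b <;> simp [bit]

lemma bit_mem (b : ℕ → Bool) : Memℓp (fun k => (1 / 2 : ℝ) ^ (k + 1) * bit (b k)) 1 := by
  apply memℓp_gen
  simp only [ENNReal.toReal_one, Real.rpow_one]
  refine Summable.of_nonneg_of_le (fun k => norm_nonneg _) (fun k => ?_)
    (summable_geometric_two)
  rw [Real.norm_of_nonneg (mul_nonneg (by positivity) (bit_nonneg _)), pow_succ]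
  have := bit_le (b k)
  have := bit_nonneg (b k)
  have : (0 : ℝ) < (1 / 2) ^ k := by positivity
  nlinarith

/-- The symbol attached to a bit sequence. -/
def xi (b : ℕ → Bool) : V := ⟨fun k => (1 / 2 : ℝ) ^ (k + 1) * bit (b k), bit_mem b⟩

lemma xi_apply (b : ℕ → Bool) (k : ℕ) : xi b k = (1 / 2 : ℝ) ^ (k + 1) * bit (b k) := rfl

lemma norm_V_ge (f : V) (s : Finset ℕ) : ∑ k ∈ s, |f k| ≤ ‖f‖ := by
  have := lp.sum_rpow_le_norm_rpow (p := 1) (by simp) f s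
  simpa using this

lemma norm_V_le (f : V) (C : ℝ) (hC : 0 ≤ C) (h : ∀ s : Finset ℕ, ∑ k ∈ s, |f k| ≤ C) :
    ‖f‖ ≤ C := by
  apply lp.norm_le_of_forall_sum_le (p := 1) (by simp) hC
  simpa using h

lemma xi_dist (b b' : ℕ → Bool) (m : ℕ) (h : ∀ k < m, b k = b' k) :
    ‖xi b - xi b'‖ ≤ (1 / 2) ^ m := by
  apply norm_V_le _ _ (by positivity)
  intro s
  have hs : HasSum (fun k : ℕ => if k < m then (0 : ℝ) else (1 / 2) ^ (k + 1)) ((1 / 2) ^ m) := by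
    have h1 : HasSum (fun k : ℕ => (1 / 2 : ℝ) ^ (k + m + 1)) ((1 / 2) ^ m) := by
      have := (hasSum_geometric_two).mul_left ((1 / 2 : ℝ) ^ (m + 1))
      have e1 : (fun k : ℕ => (1 / 2 : ℝ) ^ (k + m + 1)) =
          fun i => (1 / 2 : ℝ) ^ (m + 1) * (1 / 2) ^ i := by
        funext k; rw [← pow_add]; congr 1; omega
      have e2 : (1 / 2 : ℝ) ^ m = (1 / 2) ^ (m + 1) * 2 := by rw [pow_succ]; ring
      rw [e1, e2]; exact this
    have h2 := (hasSum_nat_add_iff' (f := fun k : ℕ => if k < m then (0 : ℝ) else (1 / 2) ^ (k + 1))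
      (g := (1 / 2) ^ m) m).1
    apply h2
    rw [Finset.sum_eq_zero (fun k hk => by simp [Finset.mem_range.1 hk])]
    simpa using h1
  refine le_trans (Finset.sum_le_sum ?_) (sum_le_hasSum s ?_ hs)
  · intro k _
    rw [lp.coeFn_sub, Pi.sub_apply, xi_apply, xi_apply]
    split_ifs with hk
    · simp [h k hk]
    · rw [← mul_sub, abs_mul, abs_of_pos (by positivity : (0 : ℝ) < (1 / 2) ^ (k + 1))]
      have : |bit (b k) - bit (b' k)| ≤ 1 := by
        have := bit_le (b k); have := bit_nonneg (b k)
        have := bit_le (b' k); have := bit_nonneg (b' k)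
        rw [abs_le]; constructor <;> linarith
      have h3 : (0 : ℝ) < (1 / 2) ^ (k + 1) := by positivity
      nlinarith
  · intro k _
    split_ifs <;> positivity

lemma xi_zero : xi (fun _ => false) = 0 := by
  ext k; simp [xi_apply, bit]

lemma xi_norm (b : ℕ → Bool) : ‖xi b‖ ≤ 1 := by
  have := xi_dist b (fun _ => false) 0 (by simp)
  simpa [xi_zero] using this

/-! ### The profile -/

/-- The union of the hyperplanes with an integer coordinate. -/
def bd (d : ℕ) : Set (Fin d → ℝ) := {t | ∃ i, ∃ n : ℤ, t i = n}

def phi {d : ℕ} (t : Fin d → ℝ) : ℝ := min 1 (4 * Metric.infDist t (bd d))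

lemma phi_nonneg {d : ℕ} (t : Fin d → ℝ) : 0 ≤ phi t :=
  le_min zero_le_one (mul_nonneg (by norm_num) Metric.infDist_nonneg)

lemma phi_le {d : ℕ} (t : Fin d → ℝ) : phi t ≤ 1 := min_le_left _ _

lemma phi_lip {d : ℕ} (t t' : Fin d → ℝ) : |phi t - phi t'| ≤ 4 * ‖t - t'‖ := by
  have h1 : |min 1 (4 * Metric.infDist t (bd d)) - min 1 (4 * Metric.infDist t' (bd d))|
      ≤ max |(1 : ℝ) - 1| |4 * Metric.infDist t (bd d) - 4 * Metric.infDist t' (bd d)| :=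
    abs_min_sub_min_le_max _ _ _ _
  have h2 := (Metric.lipschitz_infDist_pt (bd d)).dist_le_mul t t'
  rw [Real.dist_eq, dist_eq_norm] at h2
  simp only [NNReal.coe_one, one_mul] at h2
  rw [sub_self, abs_zero, max_eq_right (abs_nonneg _), ← mul_sub, abs_mul] at h1
  have : |(4 : ℝ)| = 4 := by norm_num
  rw [this] at h1
  unfold phi
  linarith

/-- Integer part, coordinatewise. -/
def fl {d : ℕ} (t : Fin d → ℝ) : Fin d → ℤ := fun i => ⌊t i⌋

lemma exists_int_between (x y : ℝ) (h : ⌊x⌋ ≠ ⌊y⌋) : ∃ n : ℤ, |x - n| ≤ |x - y| := by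
  rcases lt_or_gt_of_ne h with h | h
  · refine ⟨⌊y⌋, ?_⟩
    have h1 : x < ⌊y⌋ := Int.floor_lt.1 h
    have h2 := Int.floor_le y
    rw [abs_of_nonpos (by linarith), abs_of_nonpos (by linarith)]; linarith
  · refine ⟨⌊x⌋, ?_⟩
    have h1 : y < ⌊x⌋ := Int.floor_lt.1 h
    have h2 := Int.floor_le x
    rw [abs_of_nonneg (by linarith), abs_of_nonneg (by linarith)]; linarith

lemma phi_le_of_fl_ne {d : ℕ} (t t' : Fin d → ℝ) (h : fl t ≠ fl t') : phi t ≤ 4 * ‖t - t'‖ := by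
  obtain ⟨i, hi⟩ := Function.ne_iff.1 h
  obtain ⟨n, hn⟩ := exists_int_between _ _ hi
  have hmem : Function.update t i (n : ℝ) ∈ bd d := ⟨i, n, by simp⟩
  have h1 := Metric.infDist_le_dist_of_mem (x := t) hmem
  have h2 : dist t (Function.update t i (n : ℝ)) ≤ |t i - n| := by
    rw [dist_pi_le_iff (abs_nonneg _)]
    intro j
    by_cases hj : j = i
    · subst hj; simp [Real.dist_eq]
    · simp [hj]
  have h3 : |t i - t' i| ≤ ‖t - t'‖ := by
    have := norm_le_pi_norm (t - t') i
    simpa using this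
  refine (min_le_right _ _).trans ?_
  linarith

lemma phi_eq_one {d : ℕ} (hd : 0 < d) (t : Fin d → ℝ)
    (h : ∀ i, 1 / 4 ≤ Int.fract (t i) ∧ Int.fract (t i) ≤ 3 / 4) : phi t = 1 := by
  apply min_eq_left
  have hne : (bd d).Nonempty := ⟨fun _ => 0, ⟨0, hd⟩, 0, by simp⟩
  have : (1 / 4 : ℝ) ≤ Metric.infDist t (bd d) := by
    rw [Metric.le_infDist hne]
    rintro y ⟨i, n, hn⟩
    refine le_trans ?_ (dist_le_pi_dist t y i)
    rw [Real.dist_eq, hn]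
    have h1 := h i
    have h2 := Int.floor_add_fract (t i)
    rcases le_or_gt n ⌊t i⌋ with h3 | h3
    · have : (n : ℝ) ≤ ⌊t i⌋ := by exact_mod_cast h3
      refine le_trans ?_ (le_abs_self _)
      linarith [h1.1]
    · have : (⌊t i⌋ : ℝ) + 1 ≤ n := by exact_mod_cast h3
      refine le_trans ?_ (neg_le_abs _)
      linarith [h1.2]
  linarith

/-- Cast of an integer vector. -/
def ic {d : ℕ} (n : Fin d → ℤ) : Fin d → ℝ := fun i => n i

lemma fl_add_ic {d : ℕ} (t : Fin d → ℝ) (n : Fin d → ℤ) : fl (t + ic n) = fl t + n := by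
  ext i; simp [fl, ic]

lemma phi_add_ic {d : ℕ} (t : Fin d → ℝ) (n : Fin d → ℤ) : phi (t + ic n) = phi t := by
  have key : ∀ (t : Fin d → ℝ) (n : Fin d → ℤ), Metric.infDist (t + ic n) (bd d) ≤
      Metric.infDist t (bd d) := by
    intro t n
    rcases (bd d).eq_empty_or_nonempty with h | h
    · simp [h]
    · rw [Metric.le_infDist h]
      rintro y ⟨i, k, hk⟩
      have : y + ic n ∈ bd d := ⟨i, k + n i, by simp [ic, hk]⟩
      have := Metric.infDist_le_dist_of_mem (x := t + ic n) this
      simpa using this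
  have h1 := key t n
  have h2 := key (t + ic n) (-n)
  have h3 : t + ic n + ic (-n) = t := by ext i; simp [ic]
  rw [h3] at h2
  unfold phi
  rw [le_antisymm h1 h2]

/-! ### Signals -/

abbrev Idx (d : ℕ) := (Fin d → ℤ) × ℕ

def sig {d : ℕ} (b : Idx d → Bool) (t : Fin d → ℝ) : V := phi t • xi (fun k => b (fl t, k))

lemma sig_norm {d : ℕ} (b : Idx d → Bool) (t : Fin d → ℝ) : ‖sig b t‖ ≤ 1 := by
  unfold sig
  rw [norm_smul, Real.norm_of_nonneg (phi_nonneg t)]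
  exact mul_le_one₀ (phi_le t) (norm_nonneg _) (xi_norm _)

lemma sig_lip {d : ℕ} (b : Idx d → Bool) (t t' : Fin d → ℝ) :
    ‖sig b t - sig b t'‖ ≤ 8 * ‖t - t'‖ := by
  by_cases h : fl t = fl t'
  · unfold sig
    rw [h, ← sub_smul, norm_smul, Real.norm_eq_abs]
    have h1 := phi_lip t t'
    have h2 := xi_norm (fun k => b (fl t', k))
    have h3 := norm_nonneg (xi (fun k => b (fl t', k)))
    have h4 := norm_nonneg (t - t')
    calc _ ≤ (4 * ‖t - t'‖) * 1 := by gcongr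
      _ ≤ _ := by linarith
  · have h1 := phi_le_of_fl_ne t t' h
    have h2 := phi_le_of_fl_ne t' t (Ne.symm h)
    rw [norm_sub_rev] at h2
    refine (norm_sub_le _ _).trans ?_
    have h3 : ∀ t : Fin d → ℝ, ‖sig b t‖ ≤ phi t := by
      intro t
      unfold sig
      rw [norm_smul, Real.norm_of_nonneg (phi_nonneg t)]
      exact mul_le_of_le_one_right (phi_nonneg t) (xi_norm _)
    have hprime := h3 t'
    linarith [h3 t, hprime]

/-- Shift of a bit configuration. -/
def shift {d : ℕ} (n : Fin d → ℤ) (b : Idx d → Bool) : Idx d → Bool := fun p => b (p.1 + n, p.2)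

lemma sig_add_ic {d : ℕ} (b : Idx d → Bool) (t : Fin d → ℝ) (n : Fin d → ℤ) :
    sig b (t + ic n) = sig (shift n b) t := by
  unfold sig shift
  rw [phi_add_ic, fl_add_ic]

/-! ### The space -/

/-- The phase space. -/
def XX (d : ℕ) : Type := {f : (Fin d → ℝ) → V // ∃ s b, f = fun v => sig b (s + v)}

def wt {d : ℕ} (v : Fin d → ℝ) : ℝ := (2 : ℝ) ^ (-‖v‖)

lemma wt_pos {d : ℕ} (v : Fin d → ℝ) : 0 < wt v := by unfold wt; positivity
lemma wt_le {d : ℕ} (v : Fin d → ℝ) : wt v ≤ 1 := by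
  unfold wt
  exact Real.rpow_le_one_of_one_le_of_nonpos (by norm_num) (by simp)

def pt {d : ℕ} (s : Fin d → ℝ) (b : Idx d → Bool) : XX d := ⟨fun v => sig b (s + v), s, b, rfl⟩

lemma pt_val {d : ℕ} (s : Fin d → ℝ) (b : Idx d → Bool) (v : Fin d → ℝ) :
    (pt s b).1 v = sig b (s + v) := rfl

lemma XX.exists_pt {d : ℕ} (f : XX d) : ∃ s b, f = pt s b := by
  obtain ⟨f, s, b, rfl⟩ := f
  exact ⟨s, b, rfl⟩

lemma XX.norm_le {d : ℕ} (f : XX d) (v : Fin d → ℝ) : ‖f.1 v‖ ≤ 1 := by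
  obtain ⟨s, b, rfl⟩ := f.exists_pt
  exact sig_norm _ _

lemma XX.lip {d : ℕ} (f : XX d) (v v' : Fin d → ℝ) : ‖f.1 v - f.1 v'‖ ≤ 8 * ‖v - v'‖ := by
  obtain ⟨s, b, rfl⟩ := f.exists_pt
  have := sig_lip b (s + v) (s + v')
  simpa [pt_val] using this

lemma XX.term_le {d : ℕ} (f g : XX d) (v : Fin d → ℝ) : wt v * ‖f.1 v - g.1 v‖ ≤ 2 := by
  have h1 := f.norm_le v
  have h2 := g.norm_le v
  have h3 := norm_sub_le (f.1 v) (g.1 v)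
  have h4 := wt_le v
  have h5 := (wt_pos v).le
  have h6 := norm_nonneg (f.1 v - g.1 v)
  nlinarith

def ds {d : ℕ} (f g : XX d) : ℝ := ⨆ v, wt v * ‖f.1 v - g.1 v‖

lemma ds_bdd {d : ℕ} (f g : XX d) : BddAbove (range fun v => wt v * ‖f.1 v - g.1 v‖) :=
  ⟨2, by rintro _ ⟨v, rfl⟩; exact f.term_le g v⟩

lemma le_ds {d : ℕ} (f g : XX d) (v : Fin d → ℝ) : wt v * ‖f.1 v - g.1 v‖ ≤ ds f g :=
  le_ciSup (ds_bdd f g) v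

lemma ds_le {d : ℕ} (f g : XX d) (C : ℝ) (h : ∀ v, wt v * ‖f.1 v - g.1 v‖ ≤ C) : ds f g ≤ C :=
  ciSup_le h

instance (d : ℕ) : MetricSpace (XX d) where
  dist := ds
  dist_self f := by simp [ds]
  dist_comm f g := by simp [ds, norm_sub_rev]
  dist_triangle f g h := by
    apply ds_le
    intro v
    have h1 := le_ds f g v
    have h2 := le_ds g h v
    have h3 : ‖f.1 v - h.1 v‖ ≤ ‖f.1 v - g.1 v‖ + ‖g.1 v - h.1 v‖ := by
      rw [← sub_add_sub_cancel (f.1 v) (g.1 v) (h.1 v)]; exact norm_add_le _ _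
    have h4 := wt_pos v
    nlinarith
  eq_of_dist_eq_zero := by
    intro f g h
    apply Subtype.ext
    funext v
    have h1 := le_ds f g v
    have h0 : ds f g = 0 := h
    rw [h0] at h1
    have h2 := wt_pos v
    have h3 : ‖f.1 v - g.1 v‖ ≤ 0 := by
      by_contra hc
      push Not at hc
      have := mul_pos h2 hc
      linarith
    exact sub_eq_zero.1 (norm_le_zero_iff.1 h3)

lemma dist_def {d : ℕ} (f g : XX d) : dist f g = ds f g := rfl

lemma dist_le_two {d : ℕ} (f g : XX d) : dist f g ≤ 2 := ds_le _ _ _ (f.term_le g)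

instance (d : ℕ) : MeasurableSpace (XX d) := borel _
instance (d : ℕ) : BorelSpace (XX d) := ⟨rfl⟩

/-! ### The action -/

def act {d : ℕ} (u : Fin d → ℝ) (f : XX d) : XX d :=
  ⟨fun v => f.1 (u + v), by
    obtain ⟨s, b, rfl⟩ := f.exists_pt
    exact ⟨s + u, b, by funext v; simp [pt_val, add_assoc]⟩⟩

lemma act_val {d : ℕ} (u : Fin d → ℝ) (f : XX d) (v : Fin d → ℝ) : (act u f).1 v = f.1 (u + v) :=
  rfl

lemma act_pt {d : ℕ} (u s : Fin d → ℝ) (b : Idx d → Bool) : act u (pt s b) = pt (u + s) b := by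
  apply Subtype.ext
  funext v
  rw [act_val, pt_val, pt_val]
  congr 1
  abel

lemma act_zero {d : ℕ} (f : XX d) : act 0 f = f := by
  apply Subtype.ext; funext v; simp [act_val]

lemma act_add {d : ℕ} (u v : Fin d → ℝ) (f : XX d) : act (u + v) f = act u (act v f) := by
  apply Subtype.ext; funext w; simp only [act_val]; rw [add_left_comm, add_assoc]

lemma wt_shift {d : ℕ} (u v : Fin d → ℝ) : wt v ≤ 2 ^ ‖u‖ * wt (u + v) := by
  unfold wt
  rw [← Real.rpow_add (by norm_num)]
  apply Real.rpow_le_rpow_of_exponent_le (by norm_num)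
  have := norm_add_le u v
  linarith

lemma dist_act_le {d : ℕ} (u : Fin d → ℝ) (f g : XX d) :
    dist (act u f) (act u g) ≤ 2 ^ ‖u‖ * dist f g := by
  apply ds_le
  intro v
  have h1 := le_ds f g (u + v)
  have h2 := wt_shift u v
  simp only [act_val]
  rw [dist_def]
  calc _ ≤ (2 ^ ‖u‖ * wt (u + v)) * ‖f.1 (u + v) - g.1 (u + v)‖ := by gcongr
    _ = 2 ^ ‖u‖ * (wt (u + v) * ‖f.1 (u + v) - g.1 (u + v)‖) := by ring
    _ ≤ _ := by gcongr

lemma dist_act_act_le {d : ℕ} (u u' : Fin d → ℝ) (f : XX d) :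
    dist (act u f) (act u' f) ≤ 8 * ‖u - u'‖ := by
  apply ds_le
  intro v
  simp only [act_val]
  have h1 := f.lip (u + v) (u' + v)
  rw [add_sub_add_right_eq_sub] at h1
  have h2 := wt_le v
  have h3 := wt_pos v
  have h4 := norm_nonneg (f.1 (u + v) - f.1 (u' + v))
  nlinarith

lemma continuous_act (d : ℕ) : Continuous (fun p : (Fin d → ℝ) × XX d => act p.1 p.2) := by
  rw [continuous_iff_continuousAt]
  rintro ⟨u, f⟩
  rw [ContinuousAt, tendsto_iff_dist_tendsto_zero]
  refine squeeze_zero (g := fun p : (Fin d → ℝ) × XX d =>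
    2 ^ ‖p.1‖ * dist p.2 f + 8 * ‖p.1 - u‖) (fun _ => dist_nonneg) ?_ ?_
  · rintro ⟨u', f'⟩
    refine (dist_triangle _ (act u' f) _).trans ?_
    exact add_le_add (dist_act_le _ _ _) (dist_act_act_le _ _ _)
  · have : Continuous (fun p : (Fin d → ℝ) × XX d => 2 ^ ‖p.1‖ * dist p.2 f + 8 * ‖p.1 - u‖) := by
      refine Continuous.add (Continuous.mul ?_ (by fun_prop)) (by fun_prop)
      exact (Real.continuous_const_rpow (by norm_num)).comp (by fun_prop)
    have h := this.tendsto (u, f)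
    simpa using h

lemma isContAction (d : ℕ) : IsContAction d (act (d := d)) :=
  ⟨continuous_act d, act_zero, act_add⟩

/-- The quantization estimate. -/
lemma dist_quant {d : ℕ} (L m : ℕ) (s s' u : Fin d → ℝ) (b b' : Idx d → Bool)
    (hs' : ∀ i, 0 ≤ s' i ∧ s' i ≤ 1) (hu : ∀ i, 0 ≤ u i ∧ u i ≤ L)
    (hss : ‖s - s'‖ ≤ (1 / 2) ^ m)
    (hb : ∀ (n : Fin d → ℤ) (k : ℕ), (∀ i, -(m : ℤ) ≤ n i ∧ n i ≤ L + m + 1) → k < m →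
      b (n, k) = b' (n, k)) :
    dist (act u (pt s b)) (act u (pt s' b')) ≤ 11 * (1 / 2) ^ m := by
  apply ds_le
  intro v
  rw [act_pt, act_pt, pt_val, pt_val]
  have h1 : ‖sig b (u + s + v) - sig b (u + s' + v)‖ ≤ 8 * (1 / 2) ^ m := by
    refine (sig_lip _ _ _).trans ?_
    have : u + s + v - (u + s' + v) = s - s' := by abel
    rw [this]
    linarith
  set t := u + s' + v with ht
  have hw := wt_le v
  have hw0 := wt_pos v
  have h2 : wt v * ‖sig b t - sig b' t‖ ≤ 2 * (1 / 2) ^ m := by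
    by_cases hv : ‖v‖ ≤ m
    · have h3 : ‖sig b t - sig b' t‖ ≤ (1 / 2) ^ m := by
        unfold sig
        rw [← smul_sub, norm_smul, Real.norm_of_nonneg (phi_nonneg t)]
        have h4 : ‖xi (fun k => b (fl t, k)) - xi (fun k => b' (fl t, k))‖ ≤ (1 / 2) ^ m := by
          apply xi_dist
          intro k hk
          apply hb _ _ _ hk
          intro i
          have hvi := (norm_le_pi_norm v i).trans hv
          rw [Real.norm_eq_abs, abs_le] at hvi
          have h5 : t i = u i + s' i + v i := rfl
          have h6 := hs' i
          have h7 := hu i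
          constructor
          · apply Int.le_floor.2
            push_cast
            linarith
          · have : (⌊t i⌋ : ℝ) ≤ L + m + 1 := (Int.floor_le _).trans (by linarith)
            exact_mod_cast this
        have := phi_le t
        have := phi_nonneg t
        have := norm_nonneg (xi (fun k => b (fl t, k)) - xi (fun k => b' (fl t, k)))
        nlinarith
      have := norm_nonneg (sig b t - sig b' t)
      have : (0 : ℝ) < (1 / 2) ^ m := by positivity
      nlinarith
    · push Not at hv
      have h3 : wt v ≤ (1 / 2) ^ m := by
        unfold wt
        rw [one_div, inv_pow, ← Real.rpow_natCast, ← Real.rpow_neg (by norm_num)]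
        apply Real.rpow_le_rpow_of_exponent_le (by norm_num)
        linarith
      have h4 : ‖sig b t - sig b' t‖ ≤ 2 := by
        have := norm_sub_le (sig b t) (sig b' t)
        linarith [sig_norm b t, sig_norm b' t]
      calc wt v * ‖sig b t - sig b' t‖ ≤ (1 / 2) ^ m * 2 := by gcongr
        _ = 2 * (1 / 2) ^ m := by ring
  have h3 : ‖sig b (u + s + v) - sig b' t‖ ≤ 8 * (1 / 2) ^ m + ‖sig b t - sig b' t‖ := by
    rw [← sub_add_sub_cancel _ (sig b t) _]
    exact (norm_add_le _ _).trans (by linarith)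
  have h5 : (0 : ℝ) < (1 / 2) ^ m := by positivity
  nlinarith

lemma continuous_pt0 (d : ℕ) : Continuous (fun b : Idx d → Bool => pt (0 : Fin d → ℝ) b) := by
  rw [Metric.continuous_iff']
  intro b ε hε
  obtain ⟨m, hm⟩ := exists_pow_lt_of_lt_one (show 0 < ε / 11 by positivity)
    (show (1 / 2 : ℝ) < 1 by norm_num)
  have hfin : (({n : Fin d → ℤ | ∀ i, -(m : ℤ) ≤ n i ∧ n i ≤ (0 : ℕ) + m + 1} : Set _) ×ˢ
      ({k : ℕ | k < m})).Finite := by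
    apply Set.Finite.prod
    · apply (Set.Finite.pi (fun i : Fin d => Set.finite_Icc (-(m : ℤ)) ((0 : ℕ) + m + 1))).subset
      intro n hn i _
      exact hn i
    · exact Set.finite_lt_nat m
  have hev : ∀ᶠ b' in 𝓝 b, ∀ p ∈ (({n : Fin d → ℤ | ∀ i, -(m : ℤ) ≤ n i ∧ n i ≤ (0 : ℕ) + m + 1}
      : Set _) ×ˢ ({k : ℕ | k < m})), b' p = b p := by
    rw [Filter.eventually_all_finite hfin]
    intro p _
    have h1 : Tendsto (fun b' : Idx d → Bool => b' p) (𝓝 b) (𝓝 (b p)) :=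
      (continuous_apply p).tendsto b
    rw [nhds_discrete Bool] at h1
    exact tendsto_pure.1 h1
  filter_upwards [hev] with b' hb'
  have := dist_quant 0 m 0 0 0 b' b (by simp) (by simp) (by simp)
    (fun n k hn hk => hb' (n, k) ⟨hn, hk⟩)
  rw [act_zero, act_zero] at this
  linarith

lemma continuous_pt (d : ℕ) : Continuous (fun p : (Fin d → ℝ) × (Idx d → Bool) => pt p.1 p.2) := by
  have h : (fun p : (Fin d → ℝ) × (Idx d → Bool) => pt p.1 p.2) =
      fun p => act p.1 (pt 0 p.2) := by
    funext p; rw [act_pt, add_zero]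
  rw [h]
  exact (continuous_act d).comp (continuous_fst.prodMk ((continuous_pt0 d).comp continuous_snd))

lemma pt_add_ic {d : ℕ} (s : Fin d → ℝ) (n : Fin d → ℤ) (b : Idx d → Bool) :
    pt (s + ic n) b = pt s (shift n b) := by
  apply Subtype.ext
  funext v
  rw [pt_val, pt_val, ← sig_add_ic]
  congr 1
  abel

lemma XX.exists_pt' {d : ℕ} (f : XX d) : ∃ s b, (∀ i, 0 ≤ s i ∧ s i < 1) ∧ f = pt s b := by
  obtain ⟨s, b, rfl⟩ := f.exists_pt
  refine ⟨fun i => Int.fract (s i), shift (fl s) b, fun i => ⟨Int.fract_nonneg _,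
    Int.fract_lt_one _⟩, ?_⟩
  rw [← pt_add_ic]
  congr 1
  funext i
  simp [ic, fl]

instance (d : ℕ) : CompactSpace (XX d) := by
  have hK : IsCompact ((Set.univ.pi fun _ : Fin d => Set.Icc (0 : ℝ) 1) ×ˢ
      (Set.univ : Set (Idx d → Bool))) :=
    (isCompact_univ_pi fun _ => isCompact_Icc).prod isCompact_univ
  have h := hK.image (continuous_pt d)
  have : (fun p : (Fin d → ℝ) × (Idx d → Bool) => pt p.1 p.2) ''
      ((Set.univ.pi fun _ : Fin d => Set.Icc (0 : ℝ) 1) ×ˢ (Set.univ : Set (Idx d → Bool))) =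
      Set.univ := by
    apply Set.eq_univ_of_forall
    intro f
    obtain ⟨s, b, hs, rfl⟩ := f.exists_pt'
    exact ⟨(s, b), ⟨fun i _ => ⟨(hs i).1, (hs i).2.le⟩, trivial⟩, rfl⟩
  rw [this] at h
  exact ⟨h⟩

end

end RDX

open MeasureTheory Filter Set
open scoped ENNReal Topology NNReal

namespace RDX

noncomputable section

/-! ### Finite information theory -/

def pr {Ω S : Type*} [MeasurableSpace Ω] (P : Measure Ω) (f : Ω → S) (i : S) : ℝ :=
  (P (f ⁻¹' {i})).toReal

lemma pr_nonneg {Ω S : Type*} [MeasurableSpace Ω] (P : Measure Ω) (f : Ω → S) (i : S) :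
    0 ≤ pr P f i := ENNReal.toReal_nonneg

section fin

variable {Ω S R : Type*} [MeasurableSpace Ω] [Fintype S] [MeasurableSpace S]
  [MeasurableSingletonClass S] [Fintype R] [MeasurableSpace R]
  [MeasurableSingletonClass R] (P : Measure Ω) [IsProbabilityMeasure P]

lemma integral_comp_fin (f : Ω → S) (hf : Measurable f) (G : S → ℝ) :
    ∫ ω, G (f ω) ∂P = ∑ i, pr P f i * G i := by
  have : IsProbabilityMeasure (P.map f) := Measure.isProbabilityMeasure_map hf.aemeasurable
  rw [← integral_map (μ := P) (φ := f) (f := G) hf.aemeasurable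
    (measurable_of_finite G).aestronglyMeasurable]
  rw [integral_fintype (Integrable.of_finite)]
  apply Finset.sum_congr rfl
  intro i _
  rw [measureReal_def, Measure.map_apply hf (measurableSet_singleton i)]
  rfl

lemma pr_sum (f : Ω → S) (hf : Measurable f) (h : S → R) (G : R → ℝ) :
    ∑ j, pr P (fun ω => h (f ω)) j * G j = ∑ i, pr P f i * G (h i) := by
  rw [← integral_comp_fin P f hf (fun i => G (h i)),
    ← integral_comp_fin P (fun ω => h (f ω)) ((measurable_of_finite h).comp hf) G]

lemma pr_total (f : Ω → S) (hf : Measurable f) : ∑ i, pr P f i = 1 := by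
  have := integral_comp_fin P f hf (fun _ => 1)
  simpa using this.symm

lemma pr_le (f : Ω → S) (h : S → R) (i : S) : pr P f i ≤ pr P (fun ω => h (f ω)) (h i) := by
  apply ENNReal.toReal_mono (measure_ne_top _ _)
  apply measure_mono
  intro ω hω
  simp only [mem_preimage, mem_singleton_iff] at hω ⊢
  rw [hω]

lemma entropy_comp_le (f : Ω → S) (hf : Measurable f) (h : S → R) :
    shannonEntropy P (fun ω => h (f ω)) ≤ shannonEntropy P f := by
  unfold shannonEntropy
  apply neg_le_neg
  have h1 := pr_sum P f hf h (fun j => Real.logb 2 (pr P (fun ω => h (f ω)) j))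
  change _ ≤ ∑ j, pr P (fun ω => h (f ω)) j * Real.logb 2 (pr P (fun ω => h (f ω)) j)
  rw [h1]
  change ∑ i, pr P f i * Real.logb 2 (pr P f i) ≤ _
  apply Finset.sum_le_sum
  intro i _
  rcases (pr_nonneg P f i).eq_or_lt with h0 | h0
  · simp [← h0]
  · apply mul_le_mul_of_nonneg_left _ h0.le
    exact Real.logb_le_logb_of_le (by norm_num) h0 (pr_le P f h i)

lemma gibbs (p q : S → ℝ) (hp : ∀ i, 0 ≤ p i) (hp1 : ∑ i, p i = 1) (hq : ∀ i, 0 ≤ q i)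
    (hq1 : ∑ i, q i ≤ 1) (hpq : ∀ i, 0 < p i → 0 < q i) :
    ∑ i, p i * Real.logb 2 (q i) ≤ ∑ i, p i * Real.logb 2 (p i) := by
  have hl : 0 < Real.log 2 := Real.log_pos (by norm_num)
  have key : ∀ i, p i * Real.logb 2 (q i) - p i * Real.logb 2 (p i) ≤ (q i - p i) / Real.log 2 := by
    intro i
    rcases (hp i).eq_or_lt with h0 | h0
    · rw [← h0]; simp only [zero_mul, sub_zero]; exact div_nonneg (hq i) hl.le
    · have h1 := hpq i h0
      have h2 := Real.log_le_sub_one_of_pos (div_pos h1 h0)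
      rw [Real.log_div h1.ne' h0.ne'] at h2
      unfold Real.logb
      rw [← mul_sub, ← sub_div, ← mul_div_assoc]
      apply div_le_div_of_nonneg_right _ hl.le
      calc p i * (Real.log (q i) - Real.log (p i)) ≤ p i * (q i / p i - 1) := by gcongr
        _ = q i - p i := by field_simp
  have := Finset.sum_le_sum (fun i (_ : i ∈ Finset.univ) => key i)
  rw [Finset.sum_sub_distrib, ← Finset.sum_div, Finset.sum_sub_distrib] at this
  have h3 : (∑ i, q i - ∑ i, p i) / Real.log 2 ≤ 0 :=
    div_nonpos_of_nonpos_of_nonneg (by linarith) hl.le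
  linarith

end fin

/-- Upper bound for the mutual information with a finitely valued variable. -/
lemma mutualInfo_le {Ω A B S : Type*} [MeasurableSpace Ω] [MeasurableSpace A] [MeasurableSpace B]
    [Fintype S] [MeasurableSpace S] [MeasurableSingletonClass S]
    (P : Measure Ω) [IsProbabilityMeasure P] (X : Ω → A) (hX : Measurable X)
    (c : Ω → S) (hc : Measurable c) (y : S → B) (q : S → ℝ) (hq : ∀ i, 0 ≤ q i)
    (hq1 : ∑ i, q i ≤ 1) (hpq : ∀ ω, 0 < q (c ω)) :
    mutualInfo P X (fun ω => y (c ω)) ≤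
      ENNReal.ofReal (∑ i, pr P c i * (- Real.logb 2 (q i))) := by
  unfold mutualInfo
  refine iSup_le fun n => iSup_le fun m => iSup_le fun α => iSup_le fun hα => iSup_le fun β =>
    iSup_le fun hβ => ?_
  apply ENNReal.ofReal_le_ofReal
  have hy : Measurable y := measurable_of_finite y
  have h1 : shannonEntropy P (fun ω => α (X ω)) ≤
      shannonEntropy P (fun ω => (α (X ω), β (y (c ω)))) :=
    entropy_comp_le P (fun ω => (α (X ω), β (y (c ω))))
      ((hα.comp hX).prodMk (hβ.comp (hy.comp hc))) Prod.fst
  have h2 : shannonEntropy P (fun ω => β (y (c ω))) ≤ shannonEntropy P c :=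
    entropy_comp_le P c hc (fun i => β (y i))
  have h3 : shannonEntropy P c ≤ ∑ i, pr P c i * (- Real.logb 2 (q i)) := by
    have h4 := gibbs (pr P c) q (pr_nonneg P c) (pr_total P c hc) hq hq1 (by
      intro i hi
      have : (c ⁻¹' {i}).Nonempty := by
        by_contra hne
        rw [Set.not_nonempty_iff_eq_empty] at hne
        simp [pr, hne] at hi
      obtain ⟨ω, hω⟩ := this
      have : c ω = i := hω
      rw [← this]; exact hpq ω)
    have h5 : shannonEntropy P c = - ∑ i, pr P c i * Real.logb 2 (pr P c i) := rfl
    rw [h5]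
    simp only [mul_neg, Finset.sum_neg_distrib]
    linarith
  linarith

/-- Finite Donsker-Varadhan lower bound. -/
lemma mutualInfo_ge_fin {Ω A B : Type*} [MeasurableSpace Ω] [MeasurableSpace A] [MeasurableSpace B]
    (P : Measure Ω) [IsProbabilityMeasure P] (X : Ω → A) (hX : Measurable X)
    (Y : Ω → B) (hY : Measurable Y) {n m : ℕ} (α : A → Fin n) (hα : Measurable α)
    (β : B → Fin m) (hβ : Measurable β) (g : Fin n → Fin m → ℝ) (Z : ℝ) (hZ : 0 < Z)
    (hgZ : ∀ j, (∃ ω, β (Y ω) = j) → ∑ i, pr P (fun ω => α (X ω)) i * (2 : ℝ) ^ (g i j) ≤ Z) :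
    ENNReal.ofReal (∫ ω, g (α (X ω)) (β (Y ω)) ∂P - Real.logb 2 Z) ≤ mutualInfo P X Y := by
  unfold mutualInfo
  refine le_trans ?_ (le_iSup_of_le n <| le_iSup_of_le m <| le_iSup_of_le α <| le_iSup_of_le hα <|
    le_iSup_of_le β <| le_iSup_of_le hβ le_rfl)
  apply ENNReal.ofReal_le_ofReal
  set J : Ω → Fin n × Fin m := fun ω => (α (X ω), β (Y ω)) with hJ
  have hJm : Measurable J := (hα.comp hX).prodMk (hβ.comp hY)
  set a : Fin n → ℝ := pr P (fun ω => α (X ω)) with ha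
  set b : Fin m → ℝ := pr P (fun ω => β (Y ω)) with hb
  have hA : shannonEntropy P (fun ω => α (X ω)) = - ∑ p, pr P J p * Real.logb 2 (a p.1) := by
    rw [← pr_sum P J hJm Prod.fst (fun i => Real.logb 2 (a i))]; rfl
  have hB : shannonEntropy P (fun ω => β (Y ω)) = - ∑ p, pr P J p * Real.logb 2 (b p.2) := by
    rw [← pr_sum P J hJm Prod.snd (fun i => Real.logb 2 (b i))]; rfl
  have hAB : shannonEntropy P J = - ∑ p, pr P J p * Real.logb 2 (pr P J p) := rfl
  have hG : ∫ ω, g (α (X ω)) (β (Y ω)) ∂P = ∑ p, pr P J p * g p.1 p.2 :=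
    integral_comp_fin P J hJm (fun p => g p.1 p.2)
  have hap : ∀ p, pr P J p ≤ a p.1 := fun p => pr_le P J Prod.fst p
  have hbp : ∀ p, pr P J p ≤ b p.2 := fun p => pr_le P J Prod.snd p
  have ha0 : ∀ i, 0 ≤ a i := fun i => pr_nonneg _ _ _
  have hb0 : ∀ i, 0 ≤ b i := fun i => pr_nonneg _ _ _
  have hgb := gibbs (pr P J) (fun p => a p.1 * b p.2 * (2 : ℝ) ^ (g p.1 p.2) / Z)
    (pr_nonneg P J) (pr_total P J hJm)
    (fun p => div_nonneg (mul_nonneg (mul_nonneg (ha0 _) (hb0 _)) (by positivity)) hZ.le)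
    (by
      rw [← Finset.sum_div, div_le_one hZ, Fintype.sum_prod_type_right]
      calc ∑ j, ∑ i, a i * b j * (2 : ℝ) ^ (g i j) ≤ ∑ j, b j * Z := by
            apply Finset.sum_le_sum
            intro j _
            have : ∑ i, a i * b j * (2 : ℝ) ^ (g i j) = b j * ∑ i, a i * (2 : ℝ) ^ (g i j) := by
              rw [Finset.mul_sum]; apply Finset.sum_congr rfl; intro i _; ring
            rw [this]
            by_cases hj : ∃ ω, β (Y ω) = j
            · exact mul_le_mul_of_nonneg_left (hgZ j hj) (hb0 j)
            · have : b j = 0 := by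
                have : (fun ω => β (Y ω)) ⁻¹' {j} = ∅ := by
                  ext ω; simp only [mem_preimage, mem_singleton_iff, mem_empty_iff_false, iff_false]
                  exact fun h => hj ⟨ω, h⟩
                simp [hb, pr, this]
              rw [this]; simp
        _ = Z := by rw [← Finset.sum_mul, hb, pr_total P (fun ω => β (Y ω)) (hβ.comp hY), one_mul])
    (by
      intro p hp
      have h1 := hp.trans_le (hap p)
      have h2 := hp.trans_le (hbp p)
      positivity)
  have hexp : ∀ p, pr P J p * Real.logb 2 (a p.1 * b p.2 * (2 : ℝ) ^ (g p.1 p.2) / Z) =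
      pr P J p * Real.logb 2 (a p.1) + pr P J p * Real.logb 2 (b p.2) + pr P J p * g p.1 p.2
        - pr P J p * Real.logb 2 Z := by
    intro p
    rcases (pr_nonneg P J p).eq_or_lt with h0 | hp
    · simp [← h0]
    · have h1 := hp.trans_le (hap p)
      have h2 := hp.trans_le (hbp p)
      have h3 : (0 : ℝ) < (2 : ℝ) ^ (g p.1 p.2) := by positivity
      rw [Real.logb_div (by positivity) hZ.ne', Real.logb_mul (by positivity) h3.ne',
        Real.logb_mul h1.ne' h2.ne', Real.logb_rpow (by norm_num) (by norm_num)]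
      ring
  simp only [hexp, Finset.sum_add_distrib, Finset.sum_sub_distrib] at hgb
  rw [← Finset.sum_mul, pr_total P J hJm] at hgb
  change _ ≤ _ + _ - shannonEntropy P J
  rw [hA, hB, hAB, hG]
  linarith

/-- Uniform approximation of a kernel by a finitely valued one. -/
lemma exists_approx {A B : Type*} [MetricSpace A] [CompactSpace A] [MeasurableSpace A]
    [BorelSpace A] [Nonempty A] [MeasurableSpace B] (ρ : A → B → ℝ) (C D : ℝ) (hC : 0 ≤ C)
    (hLip : ∀ x x' y, |ρ x y - ρ x' y| ≤ C * dist x x') (hmeas : ∀ x, Measurable (ρ x))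
    (h0 : ∀ x y, 0 ≤ ρ x y) (hD : ∀ x y, ρ x y ≤ D) (η : ℝ) (hη : 0 < η) :
    ∃ (n m : ℕ) (α : A → Fin n) (β : B → Fin m) (r : Fin n → Fin m → ℝ),
      Measurable α ∧ Measurable β ∧ ∀ x y, |ρ x y - r (α x) (β y)| ≤ η := by
  obtain ⟨N, hN⟩ : ∃ N : ℕ, ∀ x : A, ∃ k ≤ N, dist (TopologicalSpace.denseSeq A k) x <
      η / (2 * (C + 1)) := by
    have hδ : 0 < η / (2 * (C + 1)) := by positivity
    obtain ⟨t, ht⟩ := isCompact_univ.elim_finite_subcover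
      (fun k : ℕ => Metric.ball (TopologicalSpace.denseSeq A k) (η / (2 * (C + 1))))
      (fun k => Metric.isOpen_ball) (by
        intro x _
        obtain ⟨k, hk⟩ := (TopologicalSpace.denseRange_denseSeq A).exists_dist_lt x hδ
        exact mem_iUnion.2 ⟨k, by simpa [Metric.mem_ball] using hk⟩)
    refine ⟨t.sup id, fun x => ?_⟩
    obtain ⟨k, hk⟩ := mem_iUnion.1 (ht (mem_univ x))
    obtain ⟨hkt, hk⟩ := mem_iUnion.1 hk
    exact ⟨k, Finset.le_sup (f := id) hkt, by rw [dist_comm]; exact hk⟩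
  set e := TopologicalSpace.denseSeq A with he
  set K : ℕ := ⌊D / (η / 2)⌋₊ with hK
  let α : A → Fin (N + 1) := fun x => Fin.ofNat (N + 1) (SimpleFunc.nearestPtInd e N x)
  let β : B → (Fin (N + 1) → Fin (K + 1)) := fun y i => Fin.ofNat (K + 1) ⌊ρ (e i) y / (η / 2)⌋₊
  let E := Fintype.equivFin (Fin (N + 1) → Fin (K + 1))
  refine ⟨N + 1, _, α, fun y => E (β y), fun i j => (η / 2) * ((E.symm j) i : ℕ), ?_, ?_, ?_⟩
  · exact (measurable_from_top (f := fun k : ℕ => Fin.ofNat (N + 1) k)).comp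
      (SimpleFunc.measurable _)
  · have hβ : Measurable β := by
      rw [measurable_pi_iff]
      intro i
      exact (measurable_from_top (f := fun k : ℕ => Fin.ofNat (K + 1) k)).comp
        (Nat.measurable_floor.comp ((hmeas _).div_const _))
    exact (measurable_of_finite E).comp hβ
  · intro x y
    simp only [Equiv.symm_apply_apply]
    have h1 : (α x : ℕ) = SimpleFunc.nearestPtInd e N x := by
      simp only [α, Fin.ofNat]
      exact Nat.mod_eq_of_lt (Nat.lt_succ_of_le (SimpleFunc.nearestPtInd_le e N x))
    have h2 : dist (e (α x)) x < η / (2 * (C + 1)) := by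
      obtain ⟨k, hk, hkx⟩ := hN x
      have h3 := SimpleFunc.edist_nearestPt_le e x hk
      have h4 : SimpleFunc.nearestPt e N x = e (α x) := by rw [h1]; rfl
      rw [h4] at h3
      rw [edist_dist, edist_dist, ENNReal.ofReal_le_ofReal_iff dist_nonneg] at h3
      exact h3.trans_lt hkx
    set z := e (α x) with hz
    have h5 : ((β y (α x) : Fin (K + 1)) : ℕ) = ⌊ρ z y / (η / 2)⌋₊ := by
      simp only [β, Fin.ofNat]
      apply Nat.mod_eq_of_lt
      apply Nat.lt_succ_of_le
      apply Nat.floor_le_floor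
      have := hD z y
      gcongr
    rw [h5]
    have h6 := Nat.floor_le (div_nonneg (h0 z y) (half_pos hη).le)
    have h7 := Nat.lt_floor_add_one (ρ z y / (η / 2))
    rw [le_div_iff₀ (half_pos hη)] at h6
    rw [div_lt_iff₀ (half_pos hη)] at h7
    have h8 := hLip x z y
    have h9 : C * dist x z ≤ η / 2 := by
      rw [dist_comm]
      calc C * dist z x ≤ (C + 1) * (η / (2 * (C + 1))) := by gcongr; linarith
        _ = η / 2 := by field_simp
    rw [abs_le] at h8 ⊢
    constructor <;> nlinarith [h8.1, h8.2]

section DV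

variable {Ω A B : Type*} [MeasurableSpace Ω] [MetricSpace A] [CompactSpace A] [MeasurableSpace A]
    [BorelSpace A] [Nonempty A] [MeasurableSpace B] (ρ : A → B → ℝ) (C D : ℝ)

lemma kernel_measurable (hC : 0 ≤ C)
    (hLip : ∀ x x' y, |ρ x y - ρ x' y| ≤ C * dist x x') (hmeas : ∀ x, Measurable (ρ x))
    (h0 : ∀ x y, 0 ≤ ρ x y) (hD : ∀ x y, ρ x y ≤ D) (X : Ω → A) (hX : Measurable X)
    (Y : Ω → B) (hY : Measurable Y) : Measurable (fun ω => ρ (X ω) (Y ω)) := by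
  choose n m α β r hα hβ hr using fun k : ℕ => exists_approx ρ C D hC hLip hmeas h0 hD
    (1 / ((k : ℝ) + 1)) (by positivity)
  refine measurable_of_tendsto_metrizable
    (f := fun k ω => r k (α k (X ω)) (β k (Y ω))) (fun k => ?_) ?_
  · exact (measurable_of_finite (fun p : Fin (n k) × Fin (m k) => r k p.1 p.2)).comp
      (((hα k).comp hX).prodMk ((hβ k).comp hY))
  · rw [tendsto_pi_nhds]
    intro ω
    rw [tendsto_iff_dist_tendsto_zero]
    refine squeeze_zero (fun _ => dist_nonneg) (fun k => ?_) tendsto_one_div_add_atTop_nhds_zero_nat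
    rw [dist_comm, Real.dist_eq]
    exact hr k _ _

/-- Donsker-Varadhan lower bound for the mutual information. -/
lemma mutualInfo_ge (hC : 0 ≤ C)
    (hLip : ∀ x x' y, |ρ x y - ρ x' y| ≤ C * dist x x') (hmeas : ∀ x, Measurable (ρ x))
    (h0 : ∀ x y, 0 ≤ ρ x y) (hD : ∀ x y, ρ x y ≤ D) (P : Measure Ω) [IsProbabilityMeasure P]
    (X : Ω → A) (hX : Measurable X) (Y : Ω → B) (hY : Measurable Y) (c Z : ℝ) (hc : 0 ≤ c)
    (hZ : 0 < Z) (hgZ : ∀ y, ∫ x, (2 : ℝ) ^ (-(c * ρ x y)) ∂(P.map X) ≤ Z) :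
    ENNReal.ofReal (-(c * ∫ ω, ρ (X ω) (Y ω) ∂P) - Real.logb 2 Z) ≤ mutualInfo P X Y := by
  have hm := kernel_measurable ρ C D hC hLip hmeas h0 hD X hX Y hY
  have hIntg : Integrable (fun ω => ρ (X ω) (Y ω)) P := by
    refine Integrable.of_bound hm.aestronglyMeasurable D (Eventually.of_forall fun ω => ?_)
    rw [Real.norm_of_nonneg (h0 _ _)]; exact hD _ _
  have key : ∀ η : ℝ, 0 < η → ENNReal.ofReal (-(c * ∫ ω, ρ (X ω) (Y ω) ∂P) - Real.logb 2 Z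
      - 2 * c * η) ≤ mutualInfo P X Y := by
    intro η hη
    obtain ⟨n, m, α, β, r, hα, hβ, hr⟩ := exists_approx ρ C D hC hLip hmeas h0 hD η hη
    have hr1 : ∀ x y, r (α x) (β y) ≤ ρ x y + η := fun x y => by
      have := abs_le.1 (hr x y); linarith
    have hr2 : ∀ x y, ρ x y - η ≤ r (α x) (β y) := fun x y => by
      have := abs_le.1 (hr x y); linarith
    refine le_trans (ENNReal.ofReal_le_ofReal ?_) (mutualInfo_ge_fin P X hX Y hY α hα β hβ
      (fun i j => -(c * r i j)) ((2 : ℝ) ^ (c * η) * Z) (by positivity) ?_)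
    · rw [Real.logb_mul (by positivity) hZ.ne', Real.logb_rpow (by norm_num) (by norm_num)]
      have h1 : ∫ ω, -(c * (ρ (X ω) (Y ω) + η)) ∂P ≤ ∫ ω, -(c * r (α (X ω)) (β (Y ω))) ∂P := by
        apply integral_mono
        · exact (((hIntg.add (integrable_const η)).const_mul c).neg)
        · have : Integrable (fun ω => (fun p : Fin n × Fin m => -(c * r p.1 p.2))
              (α (X ω), β (Y ω))) P := by
            have hJ : Measurable (fun ω => (α (X ω), β (Y ω))) :=
              (hα.comp hX).prodMk (hβ.comp hY)
            have : IsProbabilityMeasure (P.map (fun ω => (α (X ω), β (Y ω)))) :=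
              Measure.isProbabilityMeasure_map hJ.aemeasurable
            exact (Integrable.of_finite (μ := P.map (fun ω => (α (X ω), β (Y ω))))
              (f := fun p : Fin n × Fin m => -(c * r p.1 p.2))).comp_measurable hJ
          exact this
        · intro ω
          have := hr1 (X ω) (Y ω)
          simp only
          apply neg_le_neg
          gcongr
      rw [integral_neg, integral_const_mul, integral_add hIntg (integrable_const η)] at h1
      simp only [integral_const, probReal_univ, smul_eq_mul, one_mul] at h1
      nlinarith
    · rintro j ⟨ω₀, rfl⟩
      set y := Y ω₀
      rw [← integral_comp_fin P (fun ω => α (X ω)) (hα.comp hX)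
        (fun i => (2 : ℝ) ^ (-(c * r i (β y))))]
      have h2 := hgZ y
      have hmy : Measurable (fun x => ρ x y) := by
        have : Continuous (fun x => ρ x y) :=
          (LipschitzWith.of_dist_le_mul (K := ⟨C, hC⟩) (fun x x' => by
            rw [Real.dist_eq]; exact hLip x x' y)).continuous
        exact this.measurable
      have hmy2 : Measurable (fun x => (2 : ℝ) ^ (-(c * ρ x y))) :=
        measurable_const.pow ((hmy.const_mul c).neg)
      rw [integral_map hX.aemeasurable hmy2.aestronglyMeasurable] at h2
      have hb2 : ∀ x, ‖(2 : ℝ) ^ (-(c * ρ x y))‖ ≤ 1 := by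
        intro x
        rw [Real.norm_of_nonneg (by positivity)]
        apply Real.rpow_le_one_of_one_le_of_nonpos (by norm_num)
        have := mul_nonneg hc (h0 x y)
        linarith
      have hi2 : Integrable (fun ω => (2 : ℝ) ^ (-(c * ρ (X ω) y))) P :=
        Integrable.of_bound (hmy2.comp hX).aestronglyMeasurable 1
          (Eventually.of_forall fun ω => hb2 _)
      calc ∫ ω, (2 : ℝ) ^ (-(c * r (α (X ω)) (β y))) ∂P
          ≤ ∫ ω, (2 : ℝ) ^ (c * η) * (2 : ℝ) ^ (-(c * ρ (X ω) y)) ∂P := by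
            apply integral_mono_of_nonneg (Eventually.of_forall fun ω => by positivity)
              (hi2.const_mul _) (Eventually.of_forall fun ω => ?_)
            simp only
            rw [← Real.rpow_add (by norm_num)]
            apply Real.rpow_le_rpow_of_exponent_le (by norm_num)
            have := hr2 (X ω) y
            nlinarith
        _ = (2 : ℝ) ^ (c * η) * ∫ ω, (2 : ℝ) ^ (-(c * ρ (X ω) y)) ∂P := integral_const_mul _ _
        _ ≤ (2 : ℝ) ^ (c * η) * Z := by gcongr
  have hlim : Tendsto (fun η : ℝ => ENNReal.ofReal (-(c * ∫ ω, ρ (X ω) (Y ω) ∂P) - Real.logb 2 Z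
      - 2 * c * η)) (𝓝[>] 0) (𝓝 (ENNReal.ofReal (-(c * ∫ ω, ρ (X ω) (Y ω) ∂P) - Real.logb 2 Z
      - 2 * c * 0))) := by
    apply (ENNReal.continuous_ofReal.tendsto _).comp
    apply Tendsto.mono_left _ nhdsWithin_le_nhds
    exact Continuous.tendsto (by fun_prop) 0
  rw [mul_zero, sub_zero] at hlim
  refine le_of_tendsto hlim ?_
  filter_upwards [self_mem_nhdsWithin] with η hη
  exact key η hη

end DV

end

end RDX

open MeasureTheory Filter Set
open scoped ENNReal Topology NNReal

namespace RDX

noncomputable section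

/-! ### The measures -/

/-- The fair coin. -/
def coin : Measure Bool := (1 / 2 : ℝ≥0∞) • Measure.dirac true + (1 / 2 : ℝ≥0∞) • Measure.dirac false

instance : IsProbabilityMeasure coin := ⟨by
  simp [coin, ENNReal.inv_two_add_inv_two]⟩

lemma coin_integral (f : Bool → ℝ) : ∫ x, f x ∂coin = (f true + f false) / 2 := by
  unfold coin
  have h1 : ∀ x : Bool, Integrable f ((1 / 2 : ℝ≥0∞) • Measure.dirac x) := fun x =>
    (Integrable.of_finite).smul_measure (by simp)
  rw [integral_add_measure (h1 _) (h1 _), integral_smul_measure,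
    integral_smul_measure]
  simp
  ring

/-- Independent fair coins. -/
def kap (d : ℕ) : Measure (Idx d → Bool) := Measure.infinitePi (fun _ => coin)

instance (d : ℕ) : IsProbabilityMeasure (kap d) := by unfold kap; infer_instance

lemma kap_shift (d : ℕ) (n : Fin d → ℤ) : MeasurePreserving (shift n) (kap d) (kap d) := by
  have hm : Measurable (shift n : (Idx d → Bool) → (Idx d → Bool)) := by
    rw [measurable_pi_iff]; intro p; exact measurable_pi_apply _
  refine ⟨hm, ?_⟩
  unfold kap
  apply Measure.eq_infinitePi
  intro s t ht
  rw [Measure.map_apply hm (MeasurableSet.pi s.countable_toSet (fun i _ => ht i))]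
  let e : Idx d ≃ Idx d := (Equiv.addRight n).prodCongr (Equiv.refl ℕ)
  have h1 : (shift n ⁻¹' (Set.pi (↑s) t) : Set (Idx d → Bool)) =
      Set.pi (↑(s.map e.toEmbedding)) (fun p => t (e.symm p)) := by
    ext b
    simp only [mem_preimage, Set.mem_pi, Finset.mem_coe, Finset.mem_map, Equiv.coe_toEmbedding]
    constructor
    · rintro h _ ⟨i, hi, rfl⟩
      rw [Equiv.symm_apply_apply]
      exact h i hi
    · intro h i hi
      have := h (e i) ⟨i, hi, rfl⟩
      rw [Equiv.symm_apply_apply] at this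
      exact this
  rw [h1, Measure.infinitePi_pi _ (fun i _ => ht _), Finset.prod_map]
  refine Finset.prod_congr rfl fun x _ => ?_
  rw [Equiv.coe_toEmbedding, Equiv.symm_apply_apply]

/-- Keep only the bits with level in `A`. -/
def mask {d : ℕ} (A : ℕ → Bool) (b : Idx d → Bool) : Idx d → Bool := fun p => b p && A p.2

lemma mask_shift {d : ℕ} (A : ℕ → Bool) (n : Fin d → ℤ) (b : Idx d → Bool) :
    shift n (mask A b) = mask A (shift n b) := rfl

lemma measurable_ptm (d : ℕ) (A : ℕ → Bool) :
    Measurable (fun p : (Fin d → ℝ) × (Idx d → Bool) => pt p.1 (mask A p.2)) := by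
  have h : Continuous (fun p : (Fin d → ℝ) × (Idx d → Bool) => pt p.1 (mask A p.2)) := by
    refine (continuous_pt d).comp (continuous_fst.prodMk (continuous_pi fun i => ?_))
    have h2 : Continuous (fun x : Bool => x && A i.2) := continuous_of_discreteTopology
    exact h2.comp ((continuous_apply i).comp continuous_snd)
  exact h.measurable

instance (d : ℕ) : IsProbabilityMeasure (boxMeasure d 1) := ⟨by
  simp [boxMeasure, unitBox, Real.volume_pi_Ico]⟩

def nu (d : ℕ) (A : ℕ → Bool) : Measure (XX d) :=
  ((boxMeasure d 1).prod (kap d)).map (fun p => pt p.1 (mask A p.2))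

instance (d : ℕ) (A : ℕ → Bool) : IsProbabilityMeasure (nu d A) :=
  Measure.isProbabilityMeasure_map (measurable_ptm d A).aemeasurable

lemma measurable_act {d : ℕ} (u : Fin d → ℝ) : Measurable (act u : XX d → XX d) :=
  ((continuous_act d).comp (continuous_const.prodMk continuous_id)).measurable

lemma nu_invariant (d : ℕ) (A : ℕ → Bool) : MeasInvariant d act (nu d A) := by
  intro u
  unfold nu
  rw [Measure.map_map (measurable_act u) (measurable_ptm d A)]
  ext S hS
  have hm2 : Measurable (act u ∘ fun p : (Fin d → ℝ) × (Idx d → Bool) => pt p.1 (mask A p.2)) :=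
    (measurable_act u).comp (measurable_ptm d A)
  rw [Measure.map_apply hm2 hS, Measure.map_apply (measurable_ptm d A) hS]
  set E : Set ((Fin d → ℝ) × (Idx d → Bool)) :=
    (fun p : (Fin d → ℝ) × (Idx d → Bool) => pt p.1 (mask A p.2)) ⁻¹' S with hE
  have hEm : MeasurableSet E := measurable_ptm d A hS
  set G : (Fin d → ℝ) → ℝ≥0∞ := fun s => kap d (Prod.mk s ⁻¹' E) with hG
  have hGper : ∀ (s : Fin d → ℝ) (n : Fin d → ℤ), G (s + ic n) = G s := by
    intro s n
    have : (Prod.mk (s + ic n) ⁻¹' E) = shift n ⁻¹' (Prod.mk s ⁻¹' E) := by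
      ext b
      simp only [hE, mem_preimage]
      rw [pt_add_ic, mask_shift]
    simp only [hG]
    rw [this, (kap_shift d n).measure_preimage (measurable_prodMk_left hEm).nullMeasurableSet]
  have hGm : Measurable G := measurable_measure_prodMk_left hEm
  rw [Measure.prod_apply (hm2 hS), Measure.prod_apply hEm]
  have h1 : ∀ s, kap d (Prod.mk s ⁻¹' ((act u ∘ fun p : (Fin d → ℝ) × (Idx d → Bool) =>
      pt p.1 (mask A p.2)) ⁻¹' S)) = G (u + s) := by
    intro s
    simp only [hG, hE]
    congr 1
    ext b
    simp [act_pt]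
  simp_rw [h1]
  have hfd := ZSpan.isAddFundamentalDomain' (Pi.basisFun ℝ (Fin d)) volume
  rw [ZSpan.fundamentalDomain_pi_basisFun] at hfd
  have hfd2 := hfd.vadd_of_comm u
  have hbox : boxMeasure d 1 = volume.restrict (Set.univ.pi fun _ : Fin d => Set.Ico (0 : ℝ) 1) := rfl
  rw [hbox]
  have h3 := (measurePreserving_add_left (volume : Measure (Fin d → ℝ)) u).setLIntegral_comp_emb
    (measurableEmbedding_addLeft u) G (Set.univ.pi fun _ : Fin d => Set.Ico (0 : ℝ) 1)
  rw [h3]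
  have hct : Countable (Submodule.span ℤ (Set.range (Pi.basisFun ℝ (Fin d)))).toAddSubgroup :=
    inferInstanceAs (Countable (Submodule.span ℤ (Set.range (Pi.basisFun ℝ (Fin d)))))
  refine hfd2.setLIntegral_eq hfd G ?_
  rintro ⟨g, hg⟩ x
  have hg' : ∃ n : Fin d → ℤ, g = ic n := by
    rw [Submodule.mem_toAddSubgroup] at hg
    have h4 := (Pi.basisFun ℝ (Fin d)).mem_span_iff_repr_mem ℤ g
    rw [h4] at hg
    choose n hn using hg
    refine ⟨n, ?_⟩
    funext i
    have := hn i
    simp at this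
    simp [ic, this]
  obtain ⟨n, rfl⟩ := hg'
  have h5 : (⟨ic n, hg⟩ : (Submodule.span ℤ (Set.range (Pi.basisFun ℝ (Fin d)))).toAddSubgroup) +ᵥ x = x + ic n := by
    rw [add_comm]; rfl
  rw [h5, hGper]

end

end RDX

open MeasureTheory Filter Set
open scoped ENNReal Topology NNReal

namespace RDX

noncomputable section

/-! ### Lower bound: elementary inequalities -/

lemma kap_prod {d : ℕ} (s : Finset (Idx d)) (g : Idx d → Bool → ℝ) :
    ∫ b, ∏ i ∈ s, g i (b i) ∂(kap d) = ∏ i ∈ s, (g i true + g i false) / 2 := by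
  have h1 : (fun b : Idx d → Bool => ∏ i ∈ s, g i (b i)) =
      fun b => (fun y : (i : s) → Bool => ∏ i : s, g i (y i)) (s.restrict b) := by
    funext b
    simp only [Finset.restrict]
    rw [Finset.prod_coe_sort s (fun i => g i (b i))]
  rw [h1, kap]
  refine (integral_restrict_infinitePi (s := s) (μ := fun _ : Idx d => coin)
    (f := fun y : (i : s) → Bool => ∏ i : s, g i (y i)) ?_).trans ?_
  · exact (measurable_of_finite _).aestronglyMeasurable
  · rw [integral_fintype_prod_eq_prod (fun (i : s) (y : Bool) => g i y)]
    simp_rw [coin_integral]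
    rw [Finset.prod_coe_sort s (fun i => (g i true + g i false) / 2)]

lemma two_point (t x y w : ℝ) (ht : 0 ≤ t) (hx : 0 ≤ x) (hy : 0 ≤ y) (hw0 : 0 ≤ w) (hw1 : w ≤ 1)
    (hxy : w ≤ x + y) :
    ((2 : ℝ) ^ (-(t * x)) + (2 : ℝ) ^ (-(t * y))) / 2 ≤ ((1 + (2 : ℝ) ^ (-t)) / 2) ^ w := by
  have hX : (2 : ℝ) ^ (-(t * x)) ≤ 1 :=
    Real.rpow_le_one_of_one_le_of_nonpos (by norm_num) (by simp; positivity)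
  have hY : (2 : ℝ) ^ (-(t * y)) ≤ 1 :=
    Real.rpow_le_one_of_one_le_of_nonpos (by norm_num) (by simp; positivity)
  have hXY : (2 : ℝ) ^ (-(t * x)) * (2 : ℝ) ^ (-(t * y)) ≤ ((2 : ℝ) ^ (-t)) ^ w := by
    rw [← Real.rpow_add (by norm_num), ← Real.rpow_mul (by norm_num)]
    apply Real.rpow_le_rpow_of_exponent_le (by norm_num)
    nlinarith
  have h1 : (2 : ℝ) ^ (-(t * x)) + (2 : ℝ) ^ (-(t * y)) ≤ 1 + ((2 : ℝ) ^ (-t)) ^ w := by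
    nlinarith
  have h2 := (Real.concaveOn_rpow hw0 hw1).right (show (1 : ℝ) ∈ Ici 0 by simp)
    (show (2 : ℝ) ^ (-t) ∈ Ici 0 by simp; positivity)
    (show (0 : ℝ) ≤ 1 / 2 by norm_num) (show (0 : ℝ) ≤ 1 / 2 by norm_num) (by norm_num)
  simp only [smul_eq_mul, Real.one_rpow] at h2
  have h3 : (1 + (2 : ℝ) ^ (-t)) / 2 = 1 / 2 * 1 + 1 / 2 * (2 : ℝ) ^ (-t) := by ring
  rw [h3]
  linarith

lemma tele (m : ℕ) : (∏ j ∈ Finset.range m, (1 + (1 / 2 : ℝ) ^ (2 ^ j))) ≤ 2 := by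
  have h : (∏ j ∈ Finset.range m, (1 + (1 / 2 : ℝ) ^ (2 ^ j))) * (1 / 2) = 1 - (1 / 2) ^ (2 ^ m) := by
    induction m with
    | zero => norm_num
    | succ m ih =>
      rw [Finset.prod_range_succ, mul_right_comm, ih, pow_succ 2 m, pow_mul]
      ring
  have : (0 : ℝ) ≤ (1 / 2) ^ (2 ^ m) := by positivity
  linarith

/-- the number of levels below `m` in `A`. -/
def cnt (A : ℕ → Bool) (m : ℕ) : ℕ := ((Finset.range m).filter fun k => A k = true).card

lemma level_prod (A : ℕ → Bool) (m : ℕ) :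
    ∏ k ∈ (Finset.range m).filter (fun k => A k = true), ((1 + (2 : ℝ) ^ (-((2 : ℝ) ^ (m - k)))) / 2)
      ≤ (2 : ℝ) ^ (1 - (cnt A m : ℝ)) := by
  rw [Finset.prod_div_distrib, Finset.prod_const, Real.rpow_sub (by norm_num), Real.rpow_one,
    Real.rpow_natCast]
  have h1 : ∏ k ∈ (Finset.range m).filter (fun k => A k = true),
      (1 + (2 : ℝ) ^ (-((2 : ℝ) ^ (m - k)))) ≤ ∏ k ∈ Finset.range m,
      (1 + (2 : ℝ) ^ (-((2 : ℝ) ^ (m - k)))) := by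
    apply Finset.prod_le_prod_of_subset_of_one_le (Finset.filter_subset _ _)
    · intro k _; positivity
    · intro k _ _
      have : 0 ≤ (2 : ℝ) ^ (-((2 : ℝ) ^ (m - k))) := by positivity
      linarith
  have h2 : ∏ k ∈ Finset.range m, (1 + (2 : ℝ) ^ (-((2 : ℝ) ^ (m - k)))) ≤ 
      ∏ j ∈ Finset.range (m + 1), (1 + (1 / 2 : ℝ) ^ (2 ^ j)) := by
    rw [Finset.prod_range_succ', ← Finset.prod_range_reflect]
    have h3 : ∀ j, (1 / 2 : ℝ) ^ (2 ^ j) = (2 : ℝ) ^ (-((2 : ℝ) ^ j)) := by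
      intro j
      rw [Real.rpow_neg (by norm_num), one_div, inv_pow, ← Real.rpow_natCast 2 (2 ^ j)]
      push_cast
      rfl
    simp_rw [h3]
    have h5 : ∏ j ∈ Finset.range m, (1 + (2 : ℝ) ^ (-((2 : ℝ) ^ (m - (m - 1 - j))))) =
        ∏ k ∈ Finset.range m, (1 + (2 : ℝ) ^ (-((2 : ℝ) ^ (k + 1)))) := by
      refine Finset.prod_congr rfl fun k hk => ?_
      rw [Finset.mem_range] at hk
      congr 4
      omega
    rw [h5]
    apply le_mul_of_one_le_right
    · exact Finset.prod_nonneg fun k _ => by positivity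
    · have : 0 ≤ (2 : ℝ) ^ (-((2 : ℝ) ^ 0)) := by positivity
      linarith
  have h4 := tele (m + 1)
  exact div_le_div_of_nonneg_right (h1.trans (h2.trans h4)) (by positivity)

end

end RDX

open MeasureTheory Filter Set
open scoped ENNReal Topology NNReal

namespace RDX

noncomputable section

/-! ### Lower bound: geometry -/

def vv {d : ℕ} (t : Fin d → ℝ) : Fin d → ℝ := fun i => if Int.fract (t i) < 1 / 2 then 1 / 4 else -(1 / 4)

lemma vv_floor {d : ℕ} (t : Fin d → ℝ) (i : Fin d) : ⌊(t + vv t) i⌋ = ⌊t i⌋ := by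
  rw [Int.floor_eq_iff]
  have h1 := Int.floor_add_fract (t i)
  have h2 := Int.fract_nonneg (t i)
  have h3 := Int.fract_lt_one (t i)
  simp only [Pi.add_apply, vv]
  split_ifs with h <;> constructor <;> linarith

lemma vv_fl {d : ℕ} (t : Fin d → ℝ) : fl (t + vv t) = fl t := by
  funext i; exact vv_floor t i

lemma vv_phi {d : ℕ} (hd : 0 < d) (t : Fin d → ℝ) : phi (t + vv t) = 1 := by
  apply phi_eq_one hd
  intro i
  have h0 : Int.fract ((t + vv t) i) = (t + vv t) i - ⌊t i⌋ := by
    rw [← vv_floor t i, Int.self_sub_floor]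
  rw [h0]
  have h1 := Int.floor_add_fract (t i)
  have h2 := Int.fract_nonneg (t i)
  have h3 := Int.fract_lt_one (t i)
  simp only [Pi.add_apply, vv]
  split_ifs with h <;> constructor <;> linarith

lemma vv_wt {d : ℕ} (t : Fin d → ℝ) : 1 / 2 ≤ wt (vv t) := by
  have h : ‖vv t‖ ≤ 1 := by
    rw [pi_norm_le_iff_of_nonneg (by norm_num)]
    intro i
    simp only [vv]
    split_ifs <;> rw [Real.norm_eq_abs, abs_le] <;> constructor <;> norm_num
  unfold wt
  calc (1 / 2 : ℝ) = 2 ^ (-1 : ℝ) := by rw [Real.rpow_neg_one]; norm_num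
    _ ≤ _ := Real.rpow_le_rpow_of_exponent_le (by norm_num) (by linarith)

lemma measurable_vv (d : ℕ) : Measurable (vv : (Fin d → ℝ) → (Fin d → ℝ)) := by
  rw [measurable_pi_iff]
  intro i
  refine Measurable.ite ?_ measurable_const measurable_const
  exact measurableSet_lt (measurable_fract.comp (measurable_pi_apply i)) measurable_const

lemma measurable_fl (d : ℕ) : Measurable (fl : (Fin d → ℝ) → (Fin d → ℤ)) := by
  rw [measurable_pi_iff]
  intro i
  exact Int.measurable_floor.comp (measurable_pi_apply i)

lemma abs_coord_le (f : V) (k : ℕ) : |f k| ≤ ‖f‖ := by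
  simpa using norm_V_ge f {k}

lemma continuous_apply2 (d k : ℕ) : Continuous (fun p : XX d × (Fin d → ℝ) => p.1.1 p.2 k) := by
  rw [continuous_iff_continuousAt]
  rintro ⟨f, v⟩
  rw [ContinuousAt, tendsto_iff_dist_tendsto_zero]
  refine squeeze_zero (g := fun p : XX d × (Fin d → ℝ) =>
    2 ^ ‖v‖ * dist p.1 f + 8 * ‖p.2 - v‖) (fun _ => dist_nonneg) ?_ ?_
  · rintro ⟨f', v'⟩
    have h1 := le_ds f' f v
    rw [← dist_def] at h1
    have h2 := f'.lip v' v
    have h3 : ‖f'.1 v - f.1 v‖ ≤ 2 ^ ‖v‖ * dist f' f := by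
      have h4 : (2 : ℝ) ^ ‖v‖ * wt v = 1 := by
        unfold wt; rw [← Real.rpow_add (by norm_num)]; simp
      calc ‖f'.1 v - f.1 v‖ = 2 ^ ‖v‖ * (wt v * ‖f'.1 v - f.1 v‖) := by rw [← mul_assoc, h4, one_mul]
        _ ≤ _ := by gcongr
    rw [Real.dist_eq]
    have h5 : f'.1 v' k - f.1 v k = (f'.1 v' - f'.1 v) k + (f'.1 v - f.1 v) k := by
      simp
    simp only
    rw [h5]
    have h6 := abs_coord_le (f'.1 v' - f'.1 v) k
    have h7 := abs_coord_le (f'.1 v - f.1 v) k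
    have h8 := abs_add_le ((f'.1 v' - f'.1 v) k) ((f'.1 v - f.1 v) k)
    linarith
  · have hc : Continuous (fun p : XX d × (Fin d → ℝ) =>
      2 ^ ‖v‖ * dist p.1 f + 8 * ‖p.2 - v‖) := by fun_prop
    have := hc.tendsto (f, v)
    simpa using this

/-! ### The distortion kernel -/

instance (d : ℕ) (L : ℝ) : IsFiniteMeasure (boxMeasure d L) := ⟨by
  simp [boxMeasure, unitBox, Real.volume_pi_Ico]⟩

lemma box_real (d : ℕ) (L : ℝ) (hL : 0 ≤ L) : (boxMeasure d L).real univ = L ^ d := by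
  simp [boxMeasure, unitBox, Real.volume_pi_Ico, Measure.real, ENNReal.toReal_ofReal hL]

def rho {d : ℕ} {L : ℝ} (x : XX d) (y : L1Maps d L (XX d)) : ℝ :=
  ∫ u, dist (act u x) (y u) ∂(boxMeasure d L)

lemma measurable_orbit {d : ℕ} (x : XX d) : Measurable (fun u : Fin d → ℝ => act u x) :=
  ((continuous_act d).comp (continuous_id.prodMk continuous_const)).measurable

lemma rho_integrable {d : ℕ} {L : ℝ} (x : XX d) (y : L1Maps d L (XX d)) :
    Integrable (fun u => dist (act u x) (y u)) (boxMeasure d L) := by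
  refine Integrable.of_bound ((measurable_orbit x).dist y.measurable).aestronglyMeasurable 2
    (Eventually.of_forall fun u => ?_)
  rw [Real.norm_of_nonneg dist_nonneg]
  exact dist_le_two _ _

lemma rho_nonneg {d : ℕ} {L : ℝ} (x : XX d) (y : L1Maps d L (XX d)) : 0 ≤ rho x y :=
  integral_nonneg fun _ => dist_nonneg

lemma rho_le {d : ℕ} {L : ℝ} (hL : 0 ≤ L) (x : XX d) (y : L1Maps d L (XX d)) :
    rho x y ≤ 2 * L ^ d := by
  calc rho x y ≤ ∫ u, (2 : ℝ) ∂(boxMeasure d L) :=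
        integral_mono (rho_integrable x y) (integrable_const _) fun u => dist_le_two _ _
    _ = 2 * L ^ d := by rw [integral_const, box_real d L hL, smul_eq_mul, mul_comm]

lemma norm_le_of_box {d : ℕ} {L : ℝ} (hL : 0 ≤ L) (u : Fin d → ℝ) (hu : u ∈ unitBox d L) :
    ‖u‖ ≤ L := by
  rw [pi_norm_le_iff_of_nonneg hL]
  intro i
  have := hu i trivial
  rw [Real.norm_of_nonneg this.1]
  exact this.2.le

lemma measurableSet_box (d : ℕ) (L : ℝ) : MeasurableSet (unitBox d L) :=
  MeasurableSet.univ_pi fun _ => measurableSet_Ico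

lemma rho_lip {d : ℕ} {L : ℝ} (hL : 0 ≤ L) (x x' : XX d) (y : L1Maps d L (XX d)) :
    |rho x y - rho x' y| ≤ (2 ^ L * L ^ d) * dist x x' := by
  unfold rho
  rw [← integral_sub (rho_integrable x y) (rho_integrable x' y)]
  refine (abs_integral_le_integral_abs).trans ?_
  calc ∫ u, |dist (act u x) (y u) - dist (act u x') (y u)| ∂(boxMeasure d L)
      ≤ ∫ u, 2 ^ L * dist x x' ∂(boxMeasure d L) := by
        refine integral_mono_ae ((rho_integrable x y).sub (rho_integrable x' y)).abs
          (integrable_const _) ?_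
        unfold boxMeasure
        filter_upwards [ae_restrict_mem (measurableSet_box d L)] with u hu
        refine (abs_dist_sub_le _ _ _).trans ((dist_act_le u x x').trans ?_)
        have := norm_le_of_box hL u hu
        gcongr
        norm_num
    _ = (2 ^ L * L ^ d) * dist x x' := by
        rw [integral_const, box_real d L hL, smul_eq_mul]; ring

lemma rho_measurable {d : ℕ} {L : ℝ} (x : XX d) :
    Measurable (fun y : L1Maps d L (XX d) => rho x y) := by
  apply measurable_of_Iio
  intro r
  apply MeasurableSpace.measurableSet_generateFrom
  have hm : AEStronglyMeasurable (fun u => act u x) (boxMeasure d L) :=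
    (measurable_orbit x).aestronglyMeasurable
  refine ⟨AEEqFun.mk (fun u => act u x) hm, r, ?_⟩
  ext y
  simp only [mem_preimage, mem_Iio, mem_setOf_eq]
  have : rho x y = L1dist (AEEqFun.mk (fun u => act u x) hm) y := by
    unfold rho L1dist
    refine integral_congr_ae ?_
    filter_upwards [AEEqFun.coeFn_mk (fun u => act u x) hm] with u hu
    rw [hu]
  rw [this]

end

end RDX

open MeasureTheory Filter Set
open scoped ENNReal Topology NNReal

namespace RDX

noncomputable section

/-! ### Lower bound: partition function -/

def zz {d : ℕ} {L : ℝ} (s : Fin d → ℝ) (y : L1Maps d L (XX d)) (k : ℕ) (u : Fin d → ℝ) : ℝ :=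
  2 ^ (k + 1) * (y u).1 (vv (u + s)) k

lemma zz_measurable {d : ℕ} {L : ℝ} (s : Fin d → ℝ) (y : L1Maps d L (XX d)) (k : ℕ) :
    Measurable (zz s y k) := by
  unfold zz
  apply Measurable.const_mul
  exact (continuous_apply2 d k).measurable.comp (y.measurable.prodMk
    ((measurable_vv d).comp (measurable_id.add_const s)))

lemma zz_bound {d : ℕ} {L : ℝ} (s : Fin d → ℝ) (y : L1Maps d L (XX d)) (k : ℕ) (u : Fin d → ℝ) :
    |zz s y k u| ≤ 2 ^ (k + 1) := by
  unfold zz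
  rw [abs_mul, abs_of_nonneg (by positivity)]
  have h := (abs_coord_le ((y u).1 (vv (u + s))) k).trans ((y u).norm_le _)
  exact mul_le_of_le_one_right (by positivity) h

lemma dist_lower {d : ℕ} (hd : 0 < d) {L : ℝ} (s : Fin d → ℝ) (y : L1Maps d L (XX d))
    (b : Idx d → Bool) (K : Finset ℕ) (u : Fin d → ℝ) :
    ∑ k ∈ K, (1 / 2 : ℝ) ^ (k + 2) * |bit (b (fl (u + s), k)) - zz s y k u| ≤
      dist (act u (pt s b)) (y u) := by
  rw [act_pt]
  have h1 := le_ds (pt (u + s) b) (y u) (vv (u + s))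
  rw [dist_def]
  refine le_trans ?_ h1
  have h2 := vv_wt (u + s)
  refine le_trans ?_ (mul_le_mul_of_nonneg_right h2 (norm_nonneg _))
  have h3 := norm_V_ge ((pt (u + s) b).1 (vv (u + s)) - (y u).1 (vv (u + s))) K
  refine le_trans ?_ (mul_le_mul_of_nonneg_left h3 (by norm_num))
  rw [Finset.mul_sum]
  apply Finset.sum_le_sum
  intro k _
  have h4 : (pt (u + s) b).1 (vv (u + s)) = xi (fun k => b (fl (u + s), k)) := by
    rw [pt_val, sig, vv_phi hd, vv_fl, one_smul]
  have h5 : ((pt (u + s) b).1 (vv (u + s)) - (y u).1 (vv (u + s))) k =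
      (1 / 2) ^ (k + 1) * (bit (b (fl (u + s), k)) - zz s y k u) := by
    rw [h4, lp.coeFn_sub, Pi.sub_apply, xi_apply, zz, mul_sub, ← mul_assoc, ← mul_pow]
    norm_num
  rw [h5, abs_mul, abs_of_nonneg (show (0 : ℝ) ≤ (1 / 2) ^ (k + 1) by positivity), ← mul_assoc]
  apply le_of_eq
  ring

/-- the part of the box over the cell `n`. -/
def cell {d : ℕ} (s : Fin d → ℝ) (n : Fin d → ℤ) (u : Fin d → ℝ) (a : ℝ) : ℝ :=
  if fl (u + s) = n then a else 0

lemma cell_nonneg {d : ℕ} (s : Fin d → ℝ) (n : Fin d → ℤ) (u : Fin d → ℝ) (a : ℝ) (ha : 0 ≤ a) :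
    0 ≤ cell s n u a := by
  unfold cell; split_ifs <;> simp [ha]

lemma measurableSet_cell {d : ℕ} (s : Fin d → ℝ) (n : Fin d → ℤ) :
    MeasurableSet {u : Fin d → ℝ | fl (u + s) = n} :=
  ((measurable_fl d).comp (measurable_id.add_const s)) (measurableSet_singleton n)

lemma cell_measurable {d : ℕ} (s : Fin d → ℝ) (n : Fin d → ℤ) (f : (Fin d → ℝ) → ℝ)
    (hf : Measurable f) : Measurable (fun u => cell s n u (f u)) :=
  Measurable.ite (measurableSet_cell s n) hf measurable_const

lemma cell_integrable {d : ℕ} (L : ℝ) (s : Fin d → ℝ) (n : Fin d → ℤ) (f : (Fin d → ℝ) → ℝ)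
    (hf : Measurable f) (C : ℝ) (hC : ∀ u, |f u| ≤ C) :
    Integrable (fun u => cell s n u (f u)) (boxMeasure d L) := by
  refine Integrable.of_bound (cell_measurable s n f hf).aestronglyMeasurable C
    (Eventually.of_forall fun u => ?_)
  have := hC u
  unfold cell
  split_ifs
  · exact this
  · simpa using (abs_nonneg _).trans this

def ww {d : ℕ} (L : ℝ) (s : Fin d → ℝ) (n : Fin d → ℤ) : ℝ :=
  ∫ u, cell s n u 1 ∂(boxMeasure d L)

def pp {d : ℕ} {L : ℝ} (s : Fin d → ℝ) (y : L1Maps d L (XX d)) (n : Fin d → ℤ) (k : ℕ)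
    (β : Bool) : ℝ := ∫ u, cell s n u |bit β - zz s y k u| ∂(boxMeasure d L)

lemma ww_nonneg {d : ℕ} (L : ℝ) (s : Fin d → ℝ) (n : Fin d → ℤ) : 0 ≤ ww L s n :=
  integral_nonneg fun _ => cell_nonneg _ _ _ _ zero_le_one

lemma pp_nonneg {d : ℕ} {L : ℝ} (s : Fin d → ℝ) (y : L1Maps d L (XX d)) (n : Fin d → ℤ) (k : ℕ)
    (β : Bool) : 0 ≤ pp s y n k β := integral_nonneg fun _ => cell_nonneg _ _ _ _ (abs_nonneg _)

lemma pp_integrable {d : ℕ} {L : ℝ} (s : Fin d → ℝ) (y : L1Maps d L (XX d)) (n : Fin d → ℤ) (k : ℕ)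
    (β : Bool) : Integrable (fun u => cell s n u |bit β - zz s y k u|) (boxMeasure d L) := by
  refine cell_integrable L s n _ ?_ (1 + 2 ^ (k + 1)) fun u => ?_
  · exact ((zz_measurable s y k).const_sub _).abs
  · rw [abs_abs]
    have h1 := zz_bound s y k u
    have h2 := abs_sub (bit β) (zz s y k u)
    rw [abs_of_nonneg (bit_nonneg β)] at h2
    have := bit_le β
    linarith

lemma ww_le_pp {d : ℕ} {L : ℝ} (s : Fin d → ℝ) (y : L1Maps d L (XX d)) (n : Fin d → ℤ) (k : ℕ) :
    ww L s n ≤ pp s y n k true + pp s y n k false := by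
  unfold pp ww
  rw [← integral_add (pp_integrable s y n k true) (pp_integrable s y n k false)]
  refine integral_mono (cell_integrable L s n _ measurable_const 1 (by simp))
    ((pp_integrable s y n k true).add (pp_integrable s y n k false)) fun u => ?_
  simp only [cell, Pi.add_apply]
  split_ifs
  · simp only [bit, if_true]
    have h1 := le_abs_self (1 - zz s y k u)
    have h2 := neg_le_abs ((0 : ℝ) - zz s y k u)
    simp at *
    linarith
  · simp

lemma ww_le_one {d : ℕ} (L : ℝ) (s : Fin d → ℝ) (n : Fin d → ℤ) : ww L s n ≤ 1 := by
  have h1 : ww L s n = (boxMeasure d L).real {u : Fin d → ℝ | fl (u + s) = n} := by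
    unfold ww cell
    rw [← integral_indicator_one (measurableSet_cell s n)]
    refine integral_congr_ae (Eventually.of_forall fun u => ?_)
    simp [Set.indicator]
  rw [h1]
  have h2 : {u : Fin d → ℝ | fl (u + s) = n} ⊆
      Set.univ.pi fun i => Set.Ico ((n i : ℝ) - s i) (n i - s i + 1) := by
    intro u hu i _
    have hi : ⌊u i + s i⌋ = n i := congrFun hu i
    rw [Int.floor_eq_iff] at hi
    constructor <;> linarith [hi.1, hi.2]
  have h3 : boxMeasure d L {u : Fin d → ℝ | fl (u + s) = n} ≤ 1 := by
    unfold boxMeasure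
    refine (Measure.restrict_apply_le _ _).trans ((measure_mono h2).trans ?_)
    rw [Real.volume_pi_Ico]
    simp
  exact ENNReal.toReal_le_of_le_ofReal (by norm_num) (by simpa using h3)

def NN {d : ℕ} (L : ℝ) (s : Fin d → ℝ) : Finset (Fin d → ℤ) :=
  Fintype.piFinset fun i => Finset.Icc ⌊s i⌋ ⌊L + s i⌋

lemma mem_NN {d : ℕ} (L : ℝ) (s u : Fin d → ℝ) (hu : u ∈ unitBox d L) : fl (u + s) ∈ NN L s := by
  rw [NN, Fintype.mem_piFinset]
  intro i
  have := hu i trivial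
  rw [Finset.mem_Icc]
  constructor
  · apply Int.floor_le_floor; simp [this.1]
  · apply Int.floor_le_floor; simp [this.2.le]

lemma ww_sum {d : ℕ} (L : ℝ) (hL : 0 ≤ L) (s : Fin d → ℝ) : ∑ n ∈ NN L s, ww L s n = L ^ d := by
  unfold ww
  rw [← integral_finsetSum]
  · have : ∫ u, ∑ n ∈ NN L s, cell s n u 1 ∂(boxMeasure d L) = ∫ u, (1 : ℝ) ∂(boxMeasure d L) := by
      refine integral_congr_ae ?_
      unfold boxMeasure
      filter_upwards [ae_restrict_mem (measurableSet_box d L)] with u hu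
      unfold cell
      rw [Finset.sum_ite_eq, if_pos (mem_NN L s u hu)]
    rw [this, integral_const, box_real d L hL, smul_eq_mul, mul_one]
  · intro n _
    exact cell_integrable L s n _ measurable_const 1 (by simp)

def KK (A : ℕ → Bool) (m : ℕ) : Finset ℕ := (Finset.range m).filter fun k => A k = true

lemma rho_lower {d : ℕ} (hd : 0 < d) {L : ℝ} (s : Fin d → ℝ) (y : L1Maps d L (XX d))
    (A : ℕ → Bool) (b : Idx d → Bool) (m : ℕ) :
    ∑ p ∈ NN L s ×ˢ KK A m, (1 / 2 : ℝ) ^ (p.2 + 2) * pp s y p.1 p.2 (b p) ≤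
      rho (pt s (mask A b)) y := by
  unfold pp rho
  simp_rw [← integral_const_mul]
  rw [← integral_finsetSum]
  · refine integral_mono_ae (integrable_finsetSum _ fun p _ =>
      (pp_integrable s y p.1 p.2 _).const_mul _) (rho_integrable _ y) ?_
    unfold boxMeasure
    filter_upwards [ae_restrict_mem (measurableSet_box d L)] with u hu
    refine le_trans (le_of_eq ?_) (dist_lower hd s y (mask A b) (KK A m) u)
    rw [Finset.sum_product_right]
    refine Finset.sum_congr rfl fun k hk => ?_
    have hA : A k = true := (Finset.mem_filter.1 hk).2
    unfold cell
    simp_rw [mul_ite, mul_zero]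
    rw [Finset.sum_ite_eq, if_pos (mem_NN L s u hu)]
    simp [mask, hA]
  · intro p _
    exact (pp_integrable s y p.1 p.2 _).const_mul _

lemma Z_bound_s {d : ℕ} (hd : 0 < d) {L : ℝ} (hL : 0 ≤ L) (s : Fin d → ℝ) (y : L1Maps d L (XX d))
    (A : ℕ → Bool) (m : ℕ) :
    ∫ b, (2 : ℝ) ^ (-(4 * 2 ^ m * rho (pt s (mask A b)) y)) ∂(kap d) ≤
      2 ^ ((1 - (cnt A m : ℝ)) * L ^ d) := by
  have hpow : ∀ k ∈ KK A m, (4 * 2 ^ m * (1 / 2 : ℝ) ^ (k + 2)) = 2 ^ (m - k) := by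
    intro k hk
    have hk' : k < m := Finset.mem_range.1 (Finset.mem_filter.1 hk).1
    obtain ⟨j, rfl⟩ := Nat.exists_eq_add_of_lt hk'
    have : k + j + 1 - k = j + 1 := by omega
    rw [this, div_pow, one_pow]
    field_simp
    ring
  have h1 : ∀ b : Idx d → Bool, (2 : ℝ) ^ (-(4 * 2 ^ m * rho (pt s (mask A b)) y)) ≤
      ∏ p ∈ NN L s ×ˢ KK A m, (2 : ℝ) ^ (-((2 : ℝ) ^ (m - p.2) * pp s y p.1 p.2 (b p))) := by
    intro b
    rw [← Real.rpow_sum_of_pos (by norm_num)]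
    apply Real.rpow_le_rpow_of_exponent_le (by norm_num)
    rw [Finset.sum_neg_distrib, neg_le_neg_iff]
    refine le_trans (le_of_eq ?_) (mul_le_mul_of_nonneg_left (rho_lower hd s y A b m)
      (show (0 : ℝ) ≤ 4 * 2 ^ m by positivity))
    rw [Finset.mul_sum]
    refine Finset.sum_congr rfl fun p hp => ?_
    rw [← mul_assoc, hpow p.2 (Finset.mem_product.1 hp).2]
  have hprodint : Integrable (fun b : Idx d → Bool => ∏ p ∈ NN L s ×ˢ KK A m,
      (2 : ℝ) ^ (-((2 : ℝ) ^ (m - p.2) * pp s y p.1 p.2 (b p)))) (kap d) := by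
    refine Integrable.of_bound (C := 1) ?_ (Eventually.of_forall fun b => ?_)
    · refine (Finset.measurable_prod _ fun p _ => ?_).aestronglyMeasurable
      exact (measurable_of_finite (fun β : Bool =>
        (2 : ℝ) ^ (-((2 : ℝ) ^ (m - p.2) * pp s y p.1 p.2 β)))).comp (measurable_pi_apply p)
    · rw [Real.norm_of_nonneg (Finset.prod_nonneg fun p _ => by positivity)]
      refine Finset.prod_le_one (fun p _ => by positivity) fun p _ => ?_
      have := pp_nonneg s y p.1 p.2 (b p)
      exact Real.rpow_le_one_of_one_le_of_nonpos (by norm_num) (by simp; positivity)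
  have h2 : ∫ b, (2 : ℝ) ^ (-(4 * 2 ^ m * rho (pt s (mask A b)) y)) ∂(kap d) ≤
      ∫ b : Idx d → Bool, ∏ p ∈ NN L s ×ˢ KK A m,
      (2 : ℝ) ^ (-((2 : ℝ) ^ (m - p.2) * pp s y p.1 p.2 (b p))) ∂(kap d) :=
    integral_mono_of_nonneg (Eventually.of_forall fun b => by positivity) hprodint
      (Eventually.of_forall h1)
  refine h2.trans ?_
  rw [kap_prod (NN L s ×ˢ KK A m)
    (fun p β => (2 : ℝ) ^ (-((2 : ℝ) ^ (m - p.2) * pp s y p.1 p.2 β)))]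
  calc ∏ p ∈ NN L s ×ˢ KK A m, ((2 : ℝ) ^ (-((2 : ℝ) ^ (m - p.2) * pp s y p.1 p.2 true)) +
        (2 : ℝ) ^ (-((2 : ℝ) ^ (m - p.2) * pp s y p.1 p.2 false))) / 2
      ≤ ∏ p ∈ NN L s ×ˢ KK A m, ((1 + (2 : ℝ) ^ (-((2 : ℝ) ^ (m - p.2)))) / 2) ^ (ww L s p.1) := by
        refine Finset.prod_le_prod (fun p _ => by positivity) fun p _ => ?_
        exact two_point _ _ _ _ (by positivity) (pp_nonneg _ _ _ _ _) (pp_nonneg _ _ _ _ _)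
          (ww_nonneg _ _ _) (ww_le_one _ _ _) (ww_le_pp _ _ _ _)
    _ = ∏ n ∈ NN L s, (∏ k ∈ KK A m, ((1 + (2 : ℝ) ^ (-((2 : ℝ) ^ (m - k)))) / 2)) ^ (ww L s n) := by
        rw [Finset.prod_product]
        refine Finset.prod_congr rfl fun n _ => ?_
        rw [← Real.finsetProd_rpow]
        intro k _
        positivity
    _ ≤ ∏ n ∈ NN L s, ((2 : ℝ) ^ (1 - (cnt A m : ℝ))) ^ (ww L s n) := by
        refine Finset.prod_le_prod (fun n _ => ?_) fun n _ => ?_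
        · exact Real.rpow_nonneg (Finset.prod_nonneg fun k _ => by positivity) _
        · refine Real.rpow_le_rpow (Finset.prod_nonneg fun k _ => by positivity) ?_ (ww_nonneg _ _ _)
          exact level_prod A m
    _ = 2 ^ ((1 - (cnt A m : ℝ)) * L ^ d) := by
        rw [← Real.rpow_sum_of_pos (by positivity), ww_sum L hL s, Real.rpow_mul (by norm_num)]

lemma Z_bound {d : ℕ} (hd : 0 < d) {L : ℝ} (hL : 0 ≤ L) (y : L1Maps d L (XX d))
    (A : ℕ → Bool) (m : ℕ) :
    ∫ x, (2 : ℝ) ^ (-(4 * 2 ^ m * rho x y)) ∂(nu d A) ≤ 2 ^ ((1 - (cnt A m : ℝ)) * L ^ d) := by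
  have hcont : Continuous (fun x => rho x y) := by
    have : LipschitzWith (Real.toNNReal (2 ^ L * L ^ d)) (fun x => rho x y) :=
      LipschitzWith.of_dist_le_mul fun x x' => by
        rw [Real.coe_toNNReal _ (by positivity)]; exact rho_lip hL x x' y
    exact this.continuous
  have hm : Measurable (fun x => (2 : ℝ) ^ (-(4 * 2 ^ m * rho x y))) :=
    (Measurable.const_pow (hcont.measurable.const_mul _).neg 2)
  unfold nu
  rw [integral_map (measurable_ptm d A).aemeasurable hm.aestronglyMeasurable]
  have hIntg : Integrable (fun p : (Fin d → ℝ) × (Idx d → Bool) =>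
      (2 : ℝ) ^ (-(4 * 2 ^ m * rho (pt p.1 (mask A p.2)) y))) ((boxMeasure d 1).prod (kap d)) := by
    refine Integrable.of_bound (hm.comp (measurable_ptm d A)).aestronglyMeasurable 1
      (Eventually.of_forall fun p => ?_)
    rw [Real.norm_of_nonneg (by positivity)]
    have := rho_nonneg (pt p.1 (mask A p.2)) y
    exact Real.rpow_le_one_of_one_le_of_nonpos (by norm_num) (by simp; positivity)
  rw [integral_prod _ hIntg]
  calc ∫ s, ∫ b, (2 : ℝ) ^ (-(4 * 2 ^ m * rho (pt s (mask A b)) y)) ∂(kap d) ∂(boxMeasure d 1)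
      ≤ ∫ s, (2 : ℝ) ^ ((1 - (cnt A m : ℝ)) * L ^ d) ∂(boxMeasure d 1) := by
        refine integral_mono hIntg.integral_prod_left (integrable_const _) fun s => ?_
        exact Z_bound_s hd hL s y A m
    _ = _ := by simp

theorem RD_lower (d : ℕ) (hd : 0 < d) (A : ℕ → Bool) (m : ℕ) :
    ENNReal.ofReal ((cnt A m : ℝ) - 5) ≤ RD d act (nu d A) ((1 / 2) ^ m) := by
  unfold RD
  refine le_iInf fun L => le_iInf fun hL => ?_
  have hLd : 0 < L ^ d := by positivity
  rw [ENNReal.le_div_iff_mul_le (by simp [hLd]) (by simp),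
    ← ENNReal.ofReal_mul' hLd.le]
  unfold RL
  refine le_iInf fun Ω => le_iInf fun _ => le_iInf fun P => le_iInf fun _ => le_iInf fun X =>
    le_iInf fun Y => le_iInf fun hX => le_iInf fun hY => le_iInf fun hlaw => le_iInf fun hdist => ?_
  have : Nonempty (XX d) := ⟨pt 0 fun _ => false⟩
  have h := mutualInfo_ge (fun (x : XX d) (y : L1Maps d L (XX d)) => rho x y) (2 ^ L * L ^ d)
    (2 * L ^ d) (by positivity) (fun x x' y => rho_lip hL.le x x' y) rho_measurable
    rho_nonneg (rho_le hL.le) P X hX Y hY (4 * 2 ^ m) (2 ^ ((1 - (cnt A m : ℝ)) * L ^ d))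
    (by positivity) (by positivity) (fun y => by rw [hlaw]; exact Z_bound hd hL.le y A m)
  refine le_trans (ENNReal.ofReal_le_ofReal ?_) h
  rw [Real.logb_rpow (by norm_num) (by norm_num)]
  have h2 : distortion d act L P X Y = (L ^ d)⁻¹ * ∫ ω, rho (X ω) (Y ω) ∂P := by
    unfold distortion
    rw [integral_const_mul]
    rfl
  rw [h2, inv_mul_lt_iff₀ hLd] at hdist
  have h3 : 4 * 2 ^ m * ∫ ω, rho (X ω) (Y ω) ∂P ≤ 4 * L ^ d := by
    calc 4 * 2 ^ m * ∫ ω, rho (X ω) (Y ω) ∂P ≤ 4 * 2 ^ m * (L ^ d * (1 / 2) ^ m) := by gcongr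
      _ = 4 * L ^ d * (2 * (1 / 2)) ^ m := by rw [mul_pow]; ring
      _ = 4 * L ^ d := by norm_num
  nlinarith

end

end RDX

open MeasureTheory Filter Set
open scoped ENNReal Topology NNReal

namespace RDX

noncomputable section

/-! ### Upper bound: coding -/

def FF (d N m : ℕ) : Finset (Fin d → ℤ) :=
  Fintype.piFinset fun _ => Finset.Icc (-(m : ℤ)) (N + m + 1)

lemma FF_card (d N m : ℕ) : (FF d N m).card = (N + 2 * m + 2) ^ d := by
  unfold FF
  rw [Fintype.card_piFinset]
  simp only [Int.card_Icc, Finset.prod_const, Finset.card_univ, Fintype.card_fin]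
  congr 1
  omega

abbrev gr (d N m : ℕ) : Finset (Idx d) := FF d N m ×ˢ Finset.range m

def ext0 {d N m : ℕ} (β : gr d N m → Bool) : Idx d → Bool :=
  fun p => if h : p ∈ gr d N m then β ⟨p, h⟩ else false

def jc {d : ℕ} (m : ℕ) (s : Fin d → ℝ) : Fin d → Fin (2 ^ m) :=
  fun i => ⟨⌊2 ^ m * s i⌋₊ % 2 ^ m, Nat.mod_lt _ (by positivity)⟩

def dec {d N m : ℕ} (j : Fin d → Fin (2 ^ m)) (β : gr d N m → Bool) : XX d :=
  pt (fun i => ((j i : ℕ) : ℝ) / 2 ^ m) (ext0 β)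

lemma jc_measurable {d : ℕ} (m : ℕ) : Measurable (jc m : (Fin d → ℝ) → Fin d → Fin (2 ^ m)) := by
  rw [measurable_pi_iff]
  intro i
  have h : Measurable (fun k : ℕ => (⟨k % 2 ^ m, Nat.mod_lt _ (by positivity)⟩ : Fin (2 ^ m))) :=
    measurable_from_top
  exact h.comp (Nat.measurable_floor.comp ((measurable_pi_apply i).const_mul _))

lemma quant {d N m : ℕ} (s u : Fin d → ℝ) (b : Idx d → Bool) (hs : ∀ i, 0 ≤ s i ∧ s i < 1)
    (hu : ∀ i, 0 ≤ u i ∧ u i ≤ N) :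
    dist (act u (pt s b)) (act u (dec (N := N) (jc m s) (fun p => b p))) ≤ 11 * (1 / 2) ^ m := by
  have hj : ∀ i, ((jc m s i : ℕ) : ℝ) = ⌊2 ^ m * s i⌋₊ := by
    intro i
    have : ⌊2 ^ m * s i⌋₊ < 2 ^ m := by
      rw [Nat.floor_lt (by have := (hs i).1; positivity)]
      push_cast
      have := (hs i).2
      have h2 : (0 : ℝ) < 2 ^ m := by positivity
      nlinarith
    simp only [jc]
    rw [Nat.mod_eq_of_lt this]
  apply dist_quant N m s _ u b _ ?_ hu ?_ ?_
  · intro i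
    refine ⟨by positivity, ?_⟩
    rw [div_le_one (by positivity)]
    exact_mod_cast (jc m s i).2.le
  · rw [pi_norm_le_iff_of_nonneg (by positivity)]
    intro i
    have h1 := Nat.floor_le (show 0 ≤ 2 ^ m * s i by have := (hs i).1; positivity)
    have h2 := Nat.lt_floor_add_one (2 ^ m * s i)
    have h3 : (0 : ℝ) < 2 ^ m := by positivity
    rw [Pi.sub_apply, hj, Real.norm_eq_abs]
    have h4 : s i - (⌊2 ^ m * s i⌋₊ : ℝ) / 2 ^ m = (2 ^ m * s i - ⌊2 ^ m * s i⌋₊) / 2 ^ m := by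
      field_simp
    rw [h4, abs_of_nonneg (div_nonneg (by linarith) h3.le), div_pow, one_pow]
    apply div_le_div_of_nonneg_right _ h3.le
    linarith
  · intro n k hn hk
    have : (n, k) ∈ gr d N m := by
      rw [Finset.mem_product, FF, Fintype.mem_piFinset]
      exact ⟨fun i => Finset.mem_Icc.2 (hn i), Finset.mem_range.2 hk⟩
    simp [ext0, this]

abbrev Code (d N m : ℕ) := Bool × (Fin d → Fin (2 ^ m)) × (gr d N m → Bool)

def qq (d N m : ℕ) (A : Bool → ℕ → Bool) (c : Code d N m) : ℝ :=
  1 / 2 * (((1 / 2) ^ m) ^ d * ∏ p : gr d N m,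
    if A c.1 p.1.2 then 1 / 2 else if c.2.2 p then 0 else 1)

lemma qq_nonneg (d N m : ℕ) (A : Bool → ℕ → Bool) (c : Code d N m) : 0 ≤ qq d N m A c := by
  unfold qq
  have : 0 ≤ ∏ p : gr d N m, (if A c.1 p.1.2 then (1 / 2 : ℝ) else if c.2.2 p then 0 else 1) :=
    Finset.prod_nonneg fun p _ => by split_ifs <;> norm_num
  positivity

lemma qq_sum (d N m : ℕ) (A : Bool → ℕ → Bool) : ∑ c, qq d N m A c = 1 := by
  unfold qq
  rw [Fintype.sum_prod_type]
  have h1 : ∀ σ : Bool, ∑ β : gr d N m → Bool, ∏ p : gr d N m,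
      (if A σ p.1.2 then (1 / 2 : ℝ) else if β p then 0 else 1) = 1 := by
    intro σ
    have := Finset.prod_univ_sum (fun _ : gr d N m => (Finset.univ : Finset Bool))
      (fun p x => if A σ p.1.2 then (1 / 2 : ℝ) else if x then 0 else 1)
    rw [Fintype.piFinset_univ] at this
    rw [← this]
    apply Finset.prod_eq_one
    intro p _
    by_cases h : A σ p.1.2 <;> simp [h]
  have h2 : ∀ σ : Bool, ∑ y : (Fin d → Fin (2 ^ m)) × (gr d N m → Bool),
      (1 / 2 : ℝ) * (((1 / 2) ^ m) ^ d * ∏ p : gr d N m,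
    if A σ p.1.2 then 1 / 2 else if y.2 p then 0 else 1) = 1 / 2 := by
    intro σ
    rw [Fintype.sum_prod_type]
    simp only
    simp_rw [← Finset.mul_sum, h1 σ]
    simp only [Finset.sum_const, Finset.card_univ, Fintype.card_pi, Fintype.card_fin,
      Finset.prod_const, nsmul_eq_mul, mul_one]
    push_cast
    have h3 : ((1 / 2 : ℝ) ^ m) ^ d * ((2 ^ m) ^ d) = 1 := by
      rw [← mul_pow, ← mul_pow]; norm_num
    linear_combination (1 / 2 : ℝ) * h3
  simp only [h2]
  simp

abbrev Om (d : ℕ) := Bool × ((Fin d → ℝ) × (Idx d → Bool))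

def PP (d : ℕ) : Measure (Om d) := coin.prod ((boxMeasure d 1).prod (kap d))

instance (d : ℕ) : IsProbabilityMeasure (PP d) := by unfold PP; infer_instance

def Xv {d : ℕ} (A : Bool → ℕ → Bool) (ω : Om d) : XX d := pt ω.2.1 (mask (A ω.1) ω.2.2)

lemma Xv_measurable {d : ℕ} (A : Bool → ℕ → Bool) : Measurable (Xv A : Om d → XX d) := by
  apply measurable_from_prod_countable_right
  intro σ
  exact measurable_ptm d (A σ)

lemma Xv_law (d : ℕ) (A : Bool → ℕ → Bool) :
    (PP d).map (Xv A) = (1 / 2 : ℝ≥0∞) • nu d (A true) + (1 / 2 : ℝ≥0∞) • nu d (A false) := by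
  ext S hS
  rw [Measure.map_apply (Xv_measurable A) hS, PP, Measure.prod_apply (Xv_measurable A hS)]
  unfold coin
  rw [lintegral_add_measure, lintegral_smul_measure, lintegral_smul_measure, lintegral_dirac,
    lintegral_dirac, Measure.add_apply, Measure.smul_apply, Measure.smul_apply, nu, nu,
    Measure.map_apply (measurable_ptm d _) hS, Measure.map_apply (measurable_ptm d _) hS]
  rfl

def cc {d : ℕ} (N m : ℕ) (A : Bool → ℕ → Bool) (ω : Om d) : Code d N m :=
  (ω.1, jc m ω.2.1, fun p => mask (A ω.1) ω.2.2 p)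

lemma cc_measurable {d : ℕ} (N m : ℕ) (A : Bool → ℕ → Bool) :
    Measurable (cc N m A : Om d → Code d N m) := by
  apply measurable_from_prod_countable_right
  intro σ
  refine measurable_const.prodMk (((jc_measurable m).comp measurable_fst).prodMk ?_)
  rw [measurable_pi_iff]
  intro p
  exact (measurable_of_finite (fun x : Bool => x && A σ p.1.2)).comp
    ((measurable_pi_apply p.1).comp measurable_snd)

lemma cnt_prod (d N m : ℕ) (A : ℕ → Bool) :
    ∏ p : gr d N m, (if A p.1.2 then (1 / 2 : ℝ) else 1) =
      (1 / 2) ^ ((N + 2 * m + 2) ^ d * cnt A m) := by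
  rw [Finset.prod_coe_sort (gr d N m) (fun p => if A p.2 then (1 / 2 : ℝ) else 1),
    Finset.prod_product]
  have h : ∏ k ∈ Finset.range m, (if A k = true then (1 / 2 : ℝ) else 1) = (1 / 2) ^ cnt A m := by
    rw [Finset.prod_ite, Finset.prod_const, Finset.prod_const_one, mul_one]
    rfl
  have h2 : ∀ x ∈ FF d N m, (∏ y ∈ Finset.range m, (if A (x, y).2 = true then (1 / 2 : ℝ) else 1)) =
      (1 / 2) ^ cnt A m := fun x _ => h
  refine (Finset.prod_congr rfl h2).trans ?_
  rw [Finset.prod_const, FF_card, ← pow_mul, mul_comm]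

lemma qq_cc {d : ℕ} (N m : ℕ) (A : Bool → ℕ → Bool) (ω : Om d) :
    qq d N m A (cc N m A ω) =
      (1 / 2) ^ (1 + m * d + (N + 2 * m + 2) ^ d * cnt (A ω.1) m) := by
  unfold qq
  have : ∏ p : gr d N m, (if A (cc N m A ω).1 p.1.2 then (1 / 2 : ℝ) else
      if (cc N m A ω).2.2 p then 0 else 1) = ∏ p : gr d N m, (if A ω.1 p.1.2 then (1 / 2 : ℝ) else 1) := by
    refine Finset.prod_congr rfl fun p _ => ?_
    by_cases h : A ω.1 p.1.2 <;> simp [cc, mask, h]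
  rw [this, cnt_prod, pow_add, pow_add, pow_one, pow_mul (1 / 2 : ℝ) m d, mul_assoc]

def YY {d : ℕ} (L : ℝ) {N m : ℕ} (c : Code d N m) : L1Maps d L (XX d) :=
  AEEqFun.mk (fun u => act u (dec c.2.1 c.2.2)) (measurable_orbit _).aestronglyMeasurable

lemma box_ae (d : ℕ) (L : ℝ) : ∀ᵐ u ∂(boxMeasure d L), u ∈ unitBox d L :=
  ae_restrict_mem (measurableSet_box d L)

lemma distortion_le {d : ℕ} (N m : ℕ) (hN : 0 < N) (A : Bool → ℕ → Bool) :
    distortion d act N (PP d) (Xv A) (fun ω => YY N (cc N m A ω)) ≤ 11 * (1 / 2) ^ m := by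
  unfold distortion
  have hae : ∀ᵐ ω ∂(PP d), ω.2.1 ∈ unitBox d 1 := by
    have h1 : Measure.QuasiMeasurePreserving (fun ω : Om d => ω.2.1) (PP d) (boxMeasure d 1) :=
      (Measure.quasiMeasurePreserving_fst).comp (Measure.quasiMeasurePreserving_snd)
    exact h1.ae (box_ae d 1)
  have hNd : (0 : ℝ) < (N : ℝ) ^ d := by positivity
  have hb : ∀ᵐ ω ∂(PP d), ((N : ℝ) ^ d)⁻¹ * ∫ u, dist (act u (Xv A ω)) (YY N (cc N m A ω) u)
      ∂(boxMeasure d N) ≤ 11 * (1 / 2) ^ m := by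
    filter_upwards [hae] with ω hω
    rw [inv_mul_le_iff₀ hNd]
    calc ∫ u, dist (act u (Xv A ω)) (YY N (cc N m A ω) u) ∂(boxMeasure d N)
        ≤ ∫ u, 11 * (1 / 2 : ℝ) ^ m ∂(boxMeasure d N) := by
          refine integral_mono_ae (rho_integrable _ _) (integrable_const _) ?_
          filter_upwards [box_ae d N, AEEqFun.coeFn_mk (fun u => act u (dec (cc N m A ω).2.1
            (cc N m A ω).2.2)) (measurable_orbit _).aestronglyMeasurable] with u hu hu2
          have hu3 : (YY N (cc N m A ω) : L1Maps d N (XX d)) u =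
            act u (dec (cc N m A ω).2.1 (cc N m A ω).2.2) := hu2
          rw [hu3]
          exact quant ω.2.1 u (mask (A ω.1) ω.2.2) (fun i => hω i trivial)
            (fun i => ⟨(hu i trivial).1, (hu i trivial).2.le⟩)
      _ = _ := by rw [integral_const, box_real d N (by positivity), smul_eq_mul]
  have h0 : ∫ ω : Om d, (11 * (1 / 2 : ℝ) ^ m) ∂(PP d) = 11 * (1 / 2) ^ m := by simp
  rw [← h0]
  refine integral_mono_of_nonneg (Eventually.of_forall fun ω => ?_) (integrable_const _) hb
  exact mul_nonneg (by positivity) (rho_nonneg _ _)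

lemma RL_upper {d : ℕ} (N m : ℕ) (hN : 0 < N) (A : Bool → ℕ → Bool) (ε : ℝ)
    (hε : 11 * (1 / 2) ^ m < ε) :
    RL d act ((1 / 2 : ℝ≥0∞) • nu d (A true) + (1 / 2 : ℝ≥0∞) • nu d (A false)) N ε ≤
      ENNReal.ofReal (1 + m * d + (N + 2 * m + 2) ^ d * ((cnt (A true) m + cnt (A false) m) / 2)) := by
  have h := mutualInfo_le (PP d) (Xv A) (Xv_measurable A) (cc N m A) (cc_measurable N m A)
    (fun c => (YY N c : L1Maps d N (XX d))) (qq d N m A) (qq_nonneg d N m A) (qq_sum d N m A).le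
    (fun ω => by rw [qq_cc]; positivity)
  unfold RL
  refine iInf_le_of_le (Om d) <| iInf_le_of_le _ <| iInf_le_of_le (PP d) <|
    iInf_le_of_le inferInstance <| iInf_le_of_le (Xv A) <|
    iInf_le_of_le (fun ω => YY N (cc N m A ω)) <| iInf_le_of_le (Xv_measurable A) <|
    iInf_le_of_le ((measurable_of_finite (fun c : Code d N m => (YY N c : L1Maps d N (XX d)))).comp (cc_measurable N m A)) <|
    iInf_le_of_le (Xv_law d A) <|
    iInf_le_of_le ((distortion_le N m hN A).trans_lt hε) ?_
  refine h.trans (ENNReal.ofReal_le_ofReal (le_of_eq ?_))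
  rw [← integral_comp_fin (PP d) (cc N m A) (cc_measurable N m A) (fun c => -Real.logb 2 (qq d N m A c))]
  have h2 : ∀ ω : Om d, -Real.logb 2 (qq d N m A (cc N m A ω)) =
      (fun σ : Bool => 1 + (m : ℝ) * d + (N + 2 * m + 2) ^ d * cnt (A σ) m) ω.1 := by
    intro ω
    rw [qq_cc, one_div, inv_pow, Real.logb_inv, neg_neg, Real.logb_pow, Real.logb_self_eq_one (by norm_num)]
    push_cast
    ring
  simp_rw [h2]
  have h3 : ∫ ω : Om d, (fun σ : Bool => 1 + (m : ℝ) * d + (N + 2 * m + 2) ^ d * cnt (A σ) m) ω.1 ∂(PP d)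
      = ∫ σ, (fun σ : Bool => 1 + (m : ℝ) * d + (N + 2 * m + 2) ^ d * cnt (A σ) m) σ ∂coin := by
    unfold PP
    refine (integral_fun_fst (μ := coin) (ν := (boxMeasure d 1).prod (kap d)) (fun σ : Bool => 1 + (m : ℝ) * d + (N + 2 * m + 2) ^ d * cnt (A σ) m)).trans ?_
    simp
  rw [h3, coin_integral]
  ring

lemma tendsto_box (d : ℕ) (hd : 0 < d) (a b c : ℝ) :
    Tendsto (fun x : ℝ => (a + (x + c) ^ d * b) / x ^ d) atTop (𝓝 b) := by
  have h1 : Tendsto (fun x : ℝ => a / x ^ d) atTop (𝓝 0) :=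
    tendsto_const_nhds.div_atTop (tendsto_pow_atTop hd.ne')
  have h2 : Tendsto (fun x : ℝ => 1 + c / x) atTop (𝓝 (1 + 0)) :=
    tendsto_const_nhds.add (tendsto_const_nhds.div_atTop tendsto_id)
  have h3 := h1.add ((h2.pow d).mul_const b)
  simp only [add_zero, one_pow, one_mul, zero_add] at h3
  refine h3.congr' ?_
  filter_upwards [eventually_gt_atTop 0] with x hx
  have : 1 + c / x = (x + c) / x := by field_simp
  rw [this, div_pow]
  field_simp

theorem RD_upper {d : ℕ} (hd : 0 < d) (m : ℕ) (A : Bool → ℕ → Bool) (ε : ℝ)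
    (hε : 11 * (1 / 2) ^ m < ε) :
    RD d act ((1 / 2 : ℝ≥0∞) • nu d (A true) + (1 / 2 : ℝ≥0∞) • nu d (A false)) ε ≤
      ENNReal.ofReal (((cnt (A true) m : ℝ) + cnt (A false) m) / 2) := by
  have h1 := ((tendsto_box d hd (1 + m * d) (((cnt (A true) m : ℝ) + cnt (A false) m) / 2)
    (2 * m + 2)).comp tendsto_natCast_atTop_atTop)
  refine ge_of_tendsto (ENNReal.tendsto_ofReal h1) ?_
  filter_upwards [eventually_gt_atTop 0] with N hN
  have hN' : (0 : ℝ) < N := by exact_mod_cast hN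
  unfold RD
  refine iInf_le_of_le (N : ℝ) <| iInf_le_of_le hN' ?_
  simp only [Function.comp]
  rw [ENNReal.ofReal_div_of_pos (by positivity)]
  refine ENNReal.div_le_div_right ((RL_upper N m hN A ε hε).trans (le_of_eq ?_)) _
  congr 1
  ring

end

end RDX

open MeasureTheory Filter Set
open scoped ENNReal Topology NNReal

namespace RDX

noncomputable section

/-! ### Upper metric mean dimension -/

lemma dSup_bdd {d : ℕ} (L : ℝ) (f g : XX d) :
    BddAbove (Set.range fun u : unitBox d L => dist (act u.1 f) (act u.1 g)) :=
  ⟨2, by rintro _ ⟨u, rfl⟩; exact dist_le_two _ _⟩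

lemma le_dSup {d : ℕ} (L : ℝ) (f g : XX d) (u : Fin d → ℝ) (hu : u ∈ unitBox d L) :
    dist (act u f) (act u g) ≤ dSup d act L f g :=
  le_ciSup (dSup_bdd L f g) ⟨u, hu⟩

lemma dSup_le {d : ℕ} (L : ℝ) (f g : XX d) (r : ℝ) (hr : 0 ≤ r)
    (h : ∀ u ∈ unitBox d L, dist (act u f) (act u g) ≤ r) : dSup d act L f g ≤ r :=
  Real.iSup_le (fun u => h u.1 u.2) hr

lemma dSup_nonneg {d : ℕ} (L : ℝ) (f g : XX d) : 0 ≤ dSup d act L f g :=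
  Real.iSup_nonneg fun _ => dist_nonneg

lemma dSup_triangle {d : ℕ} (L : ℝ) (f g h : XX d) :
    dSup d act L f g ≤ dSup d act L f h + dSup d act L g h := by
  refine dSup_le L f g _ (add_nonneg (dSup_nonneg _ _ _) (dSup_nonneg _ _ _)) fun u hu => ?_
  have h1 := le_dSup L f h u hu
  have h2 := le_dSup L g h u hu
  have h3 := dist_triangle_right (act u f) (act u g) (act u h)
  linarith

lemma isOpen_dSup {d : ℕ} (L : ℝ) (hL : 0 ≤ L) (g : XX d) (r : ℝ) :
    IsOpen {f : XX d | dSup d act L f g < r} := by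
  rw [Metric.isOpen_iff]
  intro f hf
  have hf' : dSup d act L f g < r := hf
  have hp : (0 : ℝ) < 2 ^ L := by positivity
  refine ⟨(r - dSup d act L f g) / (2 ^ L * 2), div_pos (by linarith) (by positivity), fun f' hf2 => ?_⟩
  rw [Metric.mem_ball, lt_div_iff₀ (by positivity)] at hf2
  show dSup d act L f' g < r
  refine lt_of_le_of_lt (dSup_le L f' g (2 ^ L * dist f' f + dSup d act L f g)
    (add_nonneg (by positivity) (dSup_nonneg _ _ _)) fun u hu => ?_) (by nlinarith [dist_nonneg (x := f') (y := f)])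
  have h1 := le_dSup L f g u hu
  have h2 := dist_act_le u f' f
  have h3 := dist_triangle (act u f') (act u f) (act u g)
  have h4 : (2 : ℝ) ^ ‖u‖ ≤ 2 ^ L := Real.rpow_le_rpow_of_exponent_le (by norm_num) (norm_le_of_box hL u hu)
  have h5 := mul_le_mul_of_nonneg_right h4 (dist_nonneg (x := f') (y := f))
  linarith

lemma cov_le {d : ℕ} (L : ℝ) (hL : 0 ≤ L) (m N : ℕ) (hN : L ≤ N) (ε : ℝ) (hε : 24 * (1 / 2) ^ m < ε) :
    covNum (XX d) (dSup d act L) ε ≤ 2 ^ (m * d + m * (N + 2 * m + 2) ^ d) := by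
  classical
  have h12 : (11 : ℝ) * (1 / 2) ^ m < 12 * (1 / 2) ^ m := by
    have : (0 : ℝ) < (1 / 2) ^ m := by positivity
    linarith
  let U : (Fin d → Fin (2 ^ m)) × (gr d N m → Bool) → Set (XX d) :=
    fun c => {f | dSup d act L f (dec c.1 c.2) < 12 * (1 / 2) ^ m}
  have hc : (Finset.univ.image U).card ≤ 2 ^ (m * d + m * (N + 2 * m + 2) ^ d) := by
    refine Finset.card_image_le.trans (le_of_eq ?_)
    rw [Finset.card_univ, Fintype.card_prod, Fintype.card_fun, Fintype.card_fun, Fintype.card_fin,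
      Fintype.card_fin, Fintype.card_bool, Fintype.card_coe, Finset.card_product, FF_card,
      Finset.card_range, ← pow_mul, ← pow_add, mul_comm m (_ ^ d)]
  refine le_trans (Nat.sInf_le ⟨Finset.univ.image U, rfl, ?_, ?_⟩) hc
  · intro V hV
    obtain ⟨c, -, rfl⟩ := Finset.mem_image.1 hV
    refine ⟨isOpen_dSup L hL _ _, lt_of_le_of_lt ?_ ((ENNReal.ofReal_lt_ofReal_iff
      (lt_trans (by positivity) hε)).2 hε)⟩
    refine iSup₂_le fun x hx => iSup₂_le fun y hy => ENNReal.ofReal_le_ofReal ?_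
    have h1 := dSup_triangle L x y (dec c.1 c.2)
    have h2 : dSup d act L x (dec c.1 c.2) < 12 * (1 / 2) ^ m := hx
    have h3 : dSup d act L y (dec c.1 c.2) < 12 * (1 / 2) ^ m := hy
    linarith
  · rw [Set.eq_univ_iff_forall]
    intro f
    obtain ⟨s, b, hs, rfl⟩ := XX.exists_pt' f
    refine ⟨U (jc m s, fun p => b p), Finset.mem_coe.2 (Finset.mem_image_of_mem _ (Finset.mem_univ _)), ?_⟩
    show dSup d act L _ _ < _
    refine lt_of_le_of_lt (dSup_le L _ _ (11 * (1 / 2) ^ m) (by positivity) fun u hu => ?_) h12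
    exact quant s u b hs (fun i => ⟨(hu i trivial).1, (hu i trivial).2.le.trans hN⟩)

lemma entScale_le {d : ℕ} (hd : 0 < d) (m : ℕ) (ε : ℝ) (hε : 24 * (1 / 2) ^ m < ε) :
    entScale (X := XX d) d act ε ≤ ENNReal.ofReal m := by
  unfold entScale
  have h1 := ENNReal.tendsto_ofReal (tendsto_box d hd (m * d) m (2 * m + 3))
  refine (limsup_le_limsup ?_).trans h1.limsup_eq.le
  filter_upwards [eventually_gt_atTop 0] with L hL
  apply ENNReal.ofReal_le_ofReal
  apply div_le_div_of_nonneg_right _ (by positivity)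
  have hN := Nat.le_ceil L
  have hc := cov_le (d := d) L hL.le m ⌈L⌉₊ hN ε hε
  have hN2 := (Nat.ceil_lt_add_one hL.le).le
  have h2 : Real.logb 2 (covNum (XX d) (dSup d act L) ε) ≤
      ((m * d + m * (⌈L⌉₊ + 2 * m + 2) ^ d : ℕ) : ℝ) := by
    rcases Nat.eq_zero_or_pos (covNum (XX d) (dSup d act L) ε) with h0 | h0
    · rw [h0]; simp only [Nat.cast_zero, Real.logb_zero]; positivity
    · have h0' : (0 : ℝ) < covNum (XX d) (dSup d act L) ε := by exact_mod_cast h0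
      calc Real.logb 2 (covNum (XX d) (dSup d act L) ε)
          ≤ Real.logb 2 ((2 : ℝ) ^ (m * d + m * (⌈L⌉₊ + 2 * m + 2) ^ d)) :=
            Real.logb_le_logb_of_le (by norm_num) h0' (by exact_mod_cast hc)
        _ = _ := by rw [Real.logb_pow, Real.logb_self_eq_one (by norm_num), mul_one]
  refine h2.trans ?_
  push_cast
  have h3 : ((⌈L⌉₊ : ℝ) + 2 * m + 2) ^ d ≤ (L + (2 * m + 3)) ^ d :=
    pow_le_pow_left₀ (by positivity) (by linarith) d
  have h4 := mul_le_mul_of_nonneg_right h3 (Nat.cast_nonneg (α := ℝ) m)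
  linarith

/-- choice of a dyadic scale -/
lemma exists_scale (C : ℕ) (ε : ℝ) (h0 : 0 < ε) (h1 : ε < 1) :
    ∃ m : ℕ, 2 ^ C * (1 / 2) ^ m < ε ∧ (m : ℝ) ≤ Real.logb 2 (1 / ε) + C + 1 := by
  have hl : 0 ≤ Real.logb 2 (1 / ε) :=
    Real.logb_nonneg (by norm_num) (by rw [le_div_iff₀ h0]; linarith)
  refine ⟨⌊Real.logb 2 (1 / ε)⌋₊ + C + 1, ?_, ?_⟩
  · have h2 := Nat.lt_floor_add_one (Real.logb 2 (1 / ε))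
    rw [Real.logb_lt_iff_lt_rpow (by norm_num) (by positivity)] at h2
    have h3 : (2 : ℝ) ^ ((⌊Real.logb 2 (1 / ε)⌋₊ : ℝ) + 1) = 2 ^ (⌊Real.logb 2 (1 / ε)⌋₊ + 1) := by
      exact_mod_cast Real.rpow_natCast 2 (⌊Real.logb 2 (1 / ε)⌋₊ + 1)
    rw [h3, div_lt_iff₀ h0] at h2
    have h4 : (2 : ℝ) ^ C * (1 / 2) ^ (⌊Real.logb 2 (1 / ε)⌋₊ + C + 1) =
        1 / 2 ^ (⌊Real.logb 2 (1 / ε)⌋₊ + 1) := by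
      rw [show ⌊Real.logb 2 (1 / ε)⌋₊ + C + 1 = C + (⌊Real.logb 2 (1 / ε)⌋₊ + 1) by ring, pow_add,
        ← mul_assoc, ← mul_pow, show (2 : ℝ) * (1 / 2) = 1 by norm_num, one_pow, one_mul, one_div_pow]
    rw [h4, div_lt_iff₀ (by positivity), mul_comm]
    exact h2
  · push_cast
    have := Nat.floor_le hl
    linarith

lemma tendsto_logb : Tendsto (fun ε : ℝ => Real.logb 2 (1 / ε)) (𝓝[>] 0) atTop := by
  have h := Real.tendsto_logb_atTop (b := 2) (by norm_num)
  have h2 := h.comp (tendsto_inv_nhdsGT_zero (𝕜 := ℝ))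
  refine h2.congr fun x => ?_
  simp

/-- abstract limsup bound -/
lemma limsup_bound (C : ℕ) (a : ℝ) (ha : 0 ≤ a) (F : ℝ → ℝ≥0∞)
    (h : ∀ m : ℕ, ∀ ε : ℝ, 2 ^ C * (1 / 2) ^ m < ε → F ε ≤ ENNReal.ofReal (a * m)) :
    limsup (fun ε : ℝ => F ε / ENNReal.ofReal (Real.logb 2 (1 / ε))) (𝓝[>] (0 : ℝ)) ≤
      ENNReal.ofReal a := by
  have h1 : Tendsto (fun x : ℝ => a * (x + C + 1) / x) atTop (𝓝 a) := by
    have h2 : Tendsto (fun x : ℝ => a + a * (C + 1) / x) atTop (𝓝 (a + 0)) :=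
      tendsto_const_nhds.add (tendsto_const_nhds.div_atTop tendsto_id)
    rw [add_zero] at h2
    refine h2.congr' ?_
    filter_upwards [eventually_gt_atTop 0] with x hx
    field_simp
    ring
  have h2 := ENNReal.tendsto_ofReal (h1.comp tendsto_logb)
  refine (limsup_le_limsup ?_).trans h2.limsup_eq.le
  have h3 : ∀ᶠ ε : ℝ in 𝓝[>] 0, ε < 1 :=
    (eventually_lt_nhds (show (0 : ℝ) < 1 by norm_num)).filter_mono nhdsWithin_le_nhds
  filter_upwards [h3, self_mem_nhdsWithin, tendsto_logb.eventually_gt_atTop 0] with ε hε1 hε0 hl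
  obtain ⟨m, hm, hm2⟩ := exists_scale C ε hε0 hε1
  simp only [Function.comp]
  rw [ENNReal.ofReal_div_of_pos hl]
  exact ENNReal.div_le_div_right ((h m ε hm).trans (ENNReal.ofReal_le_ofReal
    (mul_le_mul_of_nonneg_left hm2 ha))) _

theorem umdim_ne_top {d : ℕ} (hd : 0 < d) : umdim (X := XX d) d act ≠ ⊤ := by
  have h := limsup_bound 5 1 zero_le_one (fun ε => entScale (X := XX d) d act ε) (fun m ε hm => by
    rw [one_mul]
    refine entScale_le hd m ε (lt_of_le_of_lt ?_ hm)
    have : (0 : ℝ) < (1 / 2) ^ m := by positivity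
    nlinarith)
  exact (h.trans_lt ENNReal.ofReal_lt_top).ne

end

end RDX

open MeasureTheory Filter Set
open scoped ENNReal Topology NNReal

namespace RDX

noncomputable section

/-! ### The two measures -/

def AA (k : ℕ) : Bool := decide (Even (Nat.log 2 (Nat.log 2 k)))

def BB (k : ℕ) : Bool := !AA k

lemma cnt_le (A : ℕ → Bool) (m : ℕ) : cnt A m ≤ m := by
  unfold cnt
  exact (Finset.card_filter_le _ _).trans (Finset.card_range m).le

lemma cnt_AB (m : ℕ) : cnt AA m + cnt BB m = m := by
  unfold cnt
  have := Finset.card_filter_add_card_filter_not (s := Finset.range m) (fun k => AA k = true)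
  rw [Finset.card_range] at this
  refine Eq.trans ?_ this
  congr 2
  ext k
  simp [BB]

lemma cnt_ge (A : ℕ → Bool) (a m : ℕ) (h : ∀ k, a ≤ k → k < m → A k = true) :
    m ≤ cnt A m + a := by
  unfold cnt
  have : Finset.Ico a m ⊆ (Finset.range m).filter fun k => A k = true := by
    intro k hk
    rw [Finset.mem_Ico] at hk
    exact Finset.mem_filter.2 ⟨Finset.mem_range.2 hk.2, h k hk.1 hk.2⟩
  have h2 := Finset.card_le_card this
  rw [Nat.card_Ico] at h2
  omega

lemma loglog (j k : ℕ) (h1 : 2 ^ 2 ^ j ≤ k) (h2 : k < 2 ^ 2 ^ (j + 1)) :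
    Nat.log 2 (Nat.log 2 k) = j := by
  have hk : k ≠ 0 := by
    have : 0 < 2 ^ 2 ^ j := by positivity
    omega
  have h3 : 2 ^ j ≤ Nat.log 2 k := Nat.le_log_of_pow_le (by norm_num) h1
  have h4 : Nat.log 2 k < 2 ^ (j + 1) := Nat.log_lt_of_lt_pow hk h2
  have : 0 < 2 ^ j := by positivity
  exact Nat.log_eq_of_pow_le_of_lt_pow h3 h4

def good (A : ℕ → Bool) (j : ℕ) : Prop := ∀ k, 2 ^ 2 ^ j ≤ k → k < 2 ^ 2 ^ (j + 1) → A k = true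

lemma AA_freq : ∃ᶠ j in atTop, good AA j := by
  rw [frequently_atTop]
  intro n
  refine ⟨2 * n, by omega, fun k h1 h2 => ?_⟩
  unfold AA
  rw [loglog _ k h1 h2]
  simp

lemma BB_freq : ∃ᶠ j in atTop, good BB j := by
  rw [frequently_atTop]
  intro n
  refine ⟨2 * n + 1, by omega, fun k h1 h2 => ?_⟩
  unfold BB AA
  rw [loglog _ k h1 h2]
  simp

lemma urdim_lower {d : ℕ} (hd : 0 < d) (A : ℕ → Bool) (hA : ∃ᶠ j in atTop, good A j) :
    1 ≤ urdim d act (nu d A) := by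
  unfold urdim
  set l : Filter ℕ := atTop ⊓ 𝓟 {j | good A j} with hl
  have hne : l.NeBot := by
    rw [hl, ← frequently_mem_iff_neBot]; exact hA
  have hx : Tendsto (fun j : ℕ => (2 : ℝ) ^ 2 ^ j) l atTop := by
    refine Tendsto.mono_left ?_ (inf_le_left : l ≤ atTop)
    exact (tendsto_pow_atTop_atTop_of_one_lt (by norm_num)).comp
      (tendsto_pow_atTop_atTop_of_one_lt (by norm_num))
  have hm : Tendsto (fun j : ℕ => 2 ^ 2 ^ (j + 1)) l (atTop : Filter ℕ) := by
    refine Tendsto.mono_left ?_ (inf_le_left : l ≤ atTop)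
    exact (tendsto_pow_atTop_atTop_of_one_lt (by norm_num)).comp
      ((tendsto_pow_atTop_atTop_of_one_lt (by norm_num)).comp (tendsto_add_atTop_nat 1))
  have he : Tendsto (fun j : ℕ => (1 / 2 : ℝ) ^ (2 ^ 2 ^ (j + 1))) l (𝓝[>] 0) := by
    rw [tendsto_nhdsWithin_iff]
    refine ⟨(tendsto_pow_atTop_nhds_zero_of_lt_one (by norm_num) (by norm_num)).comp hm, ?_⟩
    exact Eventually.of_forall fun j => show (0 : ℝ) < _ by positivity
  have h1 : Tendsto (fun x : ℝ => (x ^ 2 - x - 5) / x ^ 2) atTop (𝓝 1) := by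
    have h2 : Tendsto (fun x : ℝ => 1 - 1 / x - 5 / x ^ 2) atTop (𝓝 (1 - 0 - 0)) :=
      (tendsto_const_nhds.sub (tendsto_const_nhds.div_atTop tendsto_id)).sub
        (tendsto_const_nhds.div_atTop (tendsto_pow_atTop (by norm_num)))
    rw [sub_zero, sub_zero] at h2
    refine h2.congr' ?_
    filter_upwards [eventually_gt_atTop 0] with x hx
    field_simp
  have h2 := ENNReal.tendsto_ofReal (h1.comp hx)
  rw [ENNReal.ofReal_one] at h2
  rw [← h2.limsup_eq]
  refine le_trans ?_ (limsup_le_limsup_of_le (f := map (fun j : ℕ => (1 / 2 : ℝ) ^ (2 ^ 2 ^ (j + 1))) l) he)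
  rw [← Filter.limsup_comp]
  refine limsup_le_limsup ?_
  have hg : ∀ᶠ j in l, good A j := (inf_le_right : l ≤ _) (mem_principal_self _)
  filter_upwards [hg] with j hj
  simp only [Function.comp]
  have hlog : Real.logb 2 (1 / (1 / 2 : ℝ) ^ (2 ^ 2 ^ (j + 1))) = ((2 : ℝ) ^ 2 ^ j) ^ 2 := by
    rw [one_div_pow, one_div_one_div, Real.logb_pow, Real.logb_self_eq_one (by norm_num), mul_one,
      ← pow_mul, ← pow_succ]
    push_cast
    rfl
  rw [hlog, ENNReal.ofReal_div_of_pos (by positivity)]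
  refine ENNReal.div_le_div_right (le_trans (ENNReal.ofReal_le_ofReal ?_) (RD_lower d hd A _)) _
  have h3 : 2 ^ 2 ^ (j + 1) ≤ cnt A (2 ^ 2 ^ (j + 1)) + 2 ^ 2 ^ j := cnt_ge A _ _ hj
  have h4 : ((2 : ℝ) ^ 2 ^ j) ^ 2 ≤ cnt A (2 ^ 2 ^ (j + 1)) + 2 ^ 2 ^ j := by
    rw [← pow_mul, ← pow_succ]
    exact_mod_cast h3
  linarith

lemma urdim_mix {d : ℕ} (hd : 0 < d) (A : Bool → ℕ → Bool) (a : ℝ) (ha : 0 ≤ a)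
    (h : ∀ m, ((cnt (A true) m : ℝ) + cnt (A false) m) / 2 ≤ a * m) :
    urdim d act ((1 / 2 : ℝ≥0∞) • nu d (A true) + (1 / 2 : ℝ≥0∞) • nu d (A false)) ≤
      ENNReal.ofReal a := by
  refine limsup_bound 4 a ha _ fun m ε hm => ?_
  refine (RD_upper hd m A ε (lt_of_le_of_lt ?_ hm)).trans (ENNReal.ofReal_le_ofReal (h m))
  have : (0 : ℝ) < (1 / 2) ^ m := by positivity
  nlinarith

lemma urdim_upper {d : ℕ} (hd : 0 < d) (A : ℕ → Bool) : urdim d act (nu d A) ≤ 1 := by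
  have h := urdim_mix hd (fun _ => A) 1 zero_le_one (fun m => by
    have : (cnt A m : ℝ) ≤ m := by exact_mod_cast cnt_le A m
    linarith)
  rw [← add_smul, ENNReal.add_halves, one_smul, ENNReal.ofReal_one] at h
  exact h

end

end RDX

/-- Proposition 5.1: the convexity inequality for the upper rate distortion dimension can be
strict, even under finite upper metric mean dimension. -/
theorem exists_action_urdim_convexity_strict (d : ℕ) (hd : 0 < d) :
    ∃ (X : Type) (_ : MetricSpace X) (_ : CompactSpace X)
      (_ : MeasurableSpace X) (_ : BorelSpace X) (T : (Fin d → ℝ) → X → X)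
      (ν₁ ν₂ : Measure X),
      IsContAction d T ∧
      IsProbabilityMeasure ν₁ ∧ IsProbabilityMeasure ν₂ ∧
      MeasInvariant d T ν₁ ∧ MeasInvariant d T ν₂ ∧
      umdim d T ≠ ⊤ ∧
      urdim d T ν₁ = 1 ∧ urdim d T ν₂ = 1 ∧
      urdim d T ((1 / 2 : ℝ≥0∞) • ν₁ + (1 / 2 : ℝ≥0∞) • ν₂) ≤ 1 / 2 := by
  refine ⟨RDX.XX d, inferInstance, inferInstance, inferInstance, inferInstance, RDX.act,
    RDX.nu d RDX.AA, RDX.nu d RDX.BB, RDX.isContAction d, inferInstance, inferInstance,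
    RDX.nu_invariant d _, RDX.nu_invariant d _, RDX.umdim_ne_top hd,
    le_antisymm (RDX.urdim_upper hd _) (RDX.urdim_lower hd _ RDX.AA_freq),
    le_antisymm (RDX.urdim_upper hd _) (RDX.urdim_lower hd _ RDX.BB_freq), ?_⟩
  have h := RDX.urdim_mix hd (fun σ => if σ then RDX.AA else RDX.BB) (1 / 2) (by norm_num)
    (fun m => by
      have : ((RDX.cnt RDX.AA m : ℝ) + RDX.cnt RDX.BB m) = m := by exact_mod_cast RDX.cnt_AB m
      simp only [if_true, Bool.false_eq_true, if_false]
      linarith)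
  simp only [if_true, Bool.false_eq_true, if_false] at h
  refine h.trans (le_of_eq ?_)
  rw [ENNReal.ofReal_div_of_pos (by norm_num)]
  simp
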